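/- (Third-order local Hardy-Rellich inequality) Assume m > 2, Q = m + (α+1)n > 6, and 0 < α ≤ 1. Then for any smooth u on a neighborhood of the closed gauge ball B_r: ∫_{B_r} u²ψ/ρ⁶ ≤ 4/((m−2)²(Q−6)²) ∫_{B_r} |∇_X(Δ_X u)|² + 2/((m−2)(Q−6)²) r^{−1} ∫_{∂B_r} (Δ_X u)² ψ/|∇ρ| + (2/(Q−6)) r^{−5} ∫_{∂B_r} u² ψ/|∇ρ|. -/

import Mathlib

open MeasureTheory Real

noncomputable section

abbrev E (m n : ℕ) := EuclideanSpace ℝ (Fin m) × EuclideanSpace ℝ (Fin n)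

/-- The gauge norm `ρ(x,y) = (|x|^{2(α+1)} + (α+1)²|y|²)^{1/(2(α+1))}`. -/
def rho {m n : ℕ} (α : ℝ) (z : E m n) : ℝ :=
  (‖z.1‖ ^ (2*(α+1)) + (α+1)^2 * ‖z.2‖^2) ^ (1/(2*(α+1)))

/-- The angle function `ψ = |x|^{2α}/ρ^{2α}`. -/
def psi {m n : ℕ} (α : ℝ) (z : E m n) : ℝ :=
  ‖z.1‖ ^ (2*α) / (rho α z) ^ (2*α)

/-- The gauge ball of radius `r`. -/
def gball {m n : ℕ} (α r : ℝ) : Set (E m n) := {z | rho α z < r}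

/-- The gauge sphere of radius `r`. -/
def gsphere {m n : ℕ} (α r : ℝ) : Set (E m n) := {z | rho α z = r}

/-- Squared norm of the Baouendi-Grushin gradient `∇_X u = (∇_x u, |x|^α ∇_y u)`. -/
def gradXsq {m n : ℕ} (α : ℝ) (u : E m n → ℝ) (z : E m n) : ℝ :=
  (∑ i, (fderiv ℝ u z (EuclideanSpace.single i 1, 0))^2)
  + ‖z.1‖ ^ (2*α) * (∑ j, (fderiv ℝ u z (0, EuclideanSpace.single j 1))^2)

/-- The Baouendi-Grushin Laplacian `Δ_X u = Δ_x u + |x|^{2α} Δ_y u`. -/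
def lapX {m n : ℕ} (α : ℝ) (u : E m n → ℝ) (z : E m n) : ℝ :=
  (∑ i, fderiv ℝ (fun w => fderiv ℝ u w (EuclideanSpace.single i 1, 0)) z
      (EuclideanSpace.single i 1, 0))
  + ‖z.1‖ ^ (2*α) *
    (∑ j, fderiv ℝ (fun w => fderiv ℝ u w (0, EuclideanSpace.single j 1)) z
      (0, EuclideanSpace.single j 1))

/-- The generator of anisotropic dilations `Zu = x·∇_x u + (α+1) y·∇_y u`. -/
def Zop {m n : ℕ} (α : ℝ) (u : E m n → ℝ) (z : E m n) : ℝ :=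
  fderiv ℝ u z (z.1, (α+1) • z.2)

/-- Euclidean norm of the full gradient of `ρ`. -/
def normGradRho {m n : ℕ} (α : ℝ) (z : E m n) : ℝ :=
  Real.sqrt ((∑ i, (fderiv ℝ (rho α) z (EuclideanSpace.single i 1, 0))^2)
    + (∑ j, (fderiv ℝ (rho α) z (0, EuclideanSpace.single j 1))^2))

/-- Splitting off the coordinate `i₀` of a real vector. -/
def splitCoordinate {ι : Type*} [DecidableEq ι] (i₀ : ι) :
    (({i // i ≠ i₀} → ℝ) × ℝ) ≃ₗ[ℝ] (ι → ℝ) where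
  toFun q i := if h : i = i₀ then q.2 else q.1 ⟨i, h⟩
  map_add' q q' := by ext i; by_cases h : i = i₀ <;> simp [h]
  map_smul' a q := by ext i; by_cases h : i = i₀ <;> simp [h]
  invFun p := (fun i => p i, p i₀)
  left_inv q := by
    ext i
    · simp [i.2]
    · simp
  right_inv p := by
    ext i
    by_cases h : i = i₀ <;> simp [h]

lemma measurePreserving_splitCoordinate {ι : Type*} [Fintype ι] [DecidableEq ι] (i₀ : ι) :
    MeasurePreserving (splitCoordinate i₀) := by
  have h5 : Measurable (splitCoordinate i₀) := by
    refine measurable_pi_lambda _ fun i => ?_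
    by_cases h : i = i₀
    · simpa [splitCoordinate, h] using measurable_snd
    · have : Measurable fun c : ({i // i ≠ i₀} → ℝ) × ℝ => c.1 ⟨i, h⟩ :=
        (measurable_pi_apply _).comp measurable_fst
      simpa [splitCoordinate, h] using this
  refine ⟨h5, (Measure.pi_eq fun s hs => ?_).symm⟩
  have hpre : splitCoordinate i₀ ⁻¹' Set.univ.pi s =
      (Set.univ.pi fun i : {i // i ≠ i₀} => s i) ×ˢ s i₀ := by
    ext q
    simp only [Set.mem_preimage, Set.mem_pi, Set.mem_univ, true_implies, Set.mem_prod]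
    refine ⟨fun h => ⟨fun i => ?_, ?_⟩, fun h i => ?_⟩
    · simpa [splitCoordinate, i.2] using h i
    · simpa [splitCoordinate] using h i₀
    · by_cases hi : i = i₀
      · subst hi
        simpa [splitCoordinate] using h.2
      · simpa [splitCoordinate, hi] using h.1 ⟨i, hi⟩
  rw [Measure.map_apply h5 (MeasurableSet.univ_pi hs), hpre, Measure.volume_eq_prod,
    Measure.prod_prod, volume_pi_pi, ← Finset.mul_prod_erase Finset.univ _ (Finset.mem_univ i₀),
    mul_comm]
  congr 1
  rw [← Finset.prod_subtype_of_mem (p := fun i => i ≠ i₀) (fun i => volume (s i)) (by simp)]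
  congr 1
  ext i
  simp [i.2]

/-- The coordinates of a pair with respect to orthonormal bases of both factors. -/
def pairCoordinates {m n : ℕ} (b : OrthonormalBasis (Fin m) ℝ (EuclideanSpace ℝ (Fin m)))
    (c : OrthonormalBasis (Fin n) ℝ (EuclideanSpace ℝ (Fin n))) :
    (Fin m ⊕ Fin n → ℝ) ≃ₗ[ℝ] E m n :=
  (LinearEquiv.sumArrowLequivProdArrow (Fin m) (Fin n) ℝ ℝ).trans
    (LinearEquiv.prodCongr ((WithLp.linearEquiv 2 ℝ _).symm.trans b.repr.symm.toLinearEquiv)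
      ((WithLp.linearEquiv 2 ℝ _).symm.trans c.repr.symm.toLinearEquiv))

lemma measurePreserving_pairCoordinates {m n : ℕ}
    (b : OrthonormalBasis (Fin m) ℝ (EuclideanSpace ℝ (Fin m)))
    (c : OrthonormalBasis (Fin n) ℝ (EuclideanSpace ℝ (Fin n))) :
    MeasurePreserving (pairCoordinates b c) := by
  have h1 := volume_measurePreserving_sumPiEquivProdPi (fun _ : Fin m ⊕ Fin n => ℝ)
  have h2 := b.measurePreserving_repr_symm.comp (PiLp.volume_preserving_toLp (Fin m))
  have h3 := c.measurePreserving_repr_symm.comp (PiLp.volume_preserving_toLp (Fin n))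
  exact (h2.prod h3).comp h1

lemma abs_pairCoordinates_symm_le {m n : ℕ}
    (b : OrthonormalBasis (Fin m) ℝ (EuclideanSpace ℝ (Fin m)))
    (c : OrthonormalBasis (Fin n) ℝ (EuclideanSpace ℝ (Fin n))) (z : E m n) (i : Fin m ⊕ Fin n) :
    |(pairCoordinates b c).symm z i| ≤ ‖z‖ := by
  rcases i with i | i
  · have h : (pairCoordinates b c).symm z (Sum.inl i) = b.repr z.1 i := rfl
    rw [h]
    calc |b.repr z.1 i| ≤ ‖b.repr z.1‖ := PiLp.norm_apply_le (b.repr z.1) i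
      _ = ‖z.1‖ := b.repr.norm_map _
      _ ≤ ‖z‖ := norm_fst_le z
  · have h : (pairCoordinates b c).symm z (Sum.inr i) = c.repr z.2 i := rfl
    rw [h]
    calc |c.repr z.2 i| ≤ ‖c.repr z.2‖ := PiLp.norm_apply_le (c.repr z.2) i
      _ = ‖z.2‖ := c.repr.norm_map _
      _ ≤ ‖z‖ := norm_snd_le z

lemma exists_orthonormalBasis_apply_eq {k : ℕ} {v : EuclideanSpace ℝ (Fin k)} (hv : ‖v‖ = 1) :
    ∃ (b : OrthonormalBasis (Fin k) ℝ (EuclideanSpace ℝ (Fin k))) (i : Fin k), b i = v := by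
  have hk : Nonempty (Fin k) := by
    by_contra h
    rw [not_nonempty_iff] at h
    have : v = 0 := Subsingleton.elim _ _
    simp [this] at hv
  obtain ⟨i⟩ := hk
  have ho : Orthonormal ℝ (({i} : Set (Fin k)).domRestrict fun _ => v) := by
    refine ⟨fun _ => hv, fun a b hab => ?_⟩
    exact absurd (Subsingleton.elim a b) hab
  obtain ⟨b, hb⟩ := ho.exists_orthonormalBasis_extension_of_card_eq (by simp)
  exact ⟨b, i, hb i rfl⟩

/-- Coordinates adapted to a unit vector `e` lying in one of the two factors. -/
lemma exists_adapted_coordinates {m n : ℕ} (e : E m n)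
    (he : (‖e.1‖ = 1 ∧ e.2 = 0) ∨ (e.1 = 0 ∧ ‖e.2‖ = 1)) :
    ∃ (J : Type) (_ : Fintype J) (Φ : ((J → ℝ) × ℝ) ≃ₗ[ℝ] E m n),
      Fintype.card J + 1 = m + n ∧ MeasurePreserving Φ ∧ Φ (0, 1) = e ∧
        ∀ z, ‖(Φ.symm z).1‖ ≤ ‖z‖ := by
  obtain ⟨b, c, i₀, hi⟩ : ∃ (b : OrthonormalBasis (Fin m) ℝ (EuclideanSpace ℝ (Fin m)))
      (c : OrthonormalBasis (Fin n) ℝ (EuclideanSpace ℝ (Fin n))) (i₀ : Fin m ⊕ Fin n),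
      pairCoordinates b c (Pi.single i₀ 1) = e := by
    rcases he with ⟨h1, h2⟩ | ⟨h1, h2⟩
    · obtain ⟨b, i, hb⟩ := exists_orthonormalBasis_apply_eq h1
      refine ⟨b, EuclideanSpace.basisFun _ ℝ, Sum.inl i, ?_⟩
      apply (pairCoordinates b _).symm.injective
      rw [LinearEquiv.symm_apply_apply]
      ext j
      rcases j with j | j
      · change _ = b.repr e.1 j
        rw [← hb]
        simp [Pi.single_apply]
      · change _ = (EuclideanSpace.basisFun _ ℝ).repr e.2 j
        simp [h2]
    · obtain ⟨c, i, hc⟩ := exists_orthonormalBasis_apply_eq h2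
      refine ⟨EuclideanSpace.basisFun _ ℝ, c, Sum.inr i, ?_⟩
      apply (pairCoordinates _ c).symm.injective
      rw [LinearEquiv.symm_apply_apply]
      ext j
      rcases j with j | j
      · change _ = (EuclideanSpace.basisFun _ ℝ).repr e.1 j
        simp [h1]
      · change _ = c.repr e.2 j
        rw [← hc]
        simp [Pi.single_apply]
  refine ⟨{i // i ≠ i₀}, inferInstance, (splitCoordinate i₀).trans (pairCoordinates b c), ?_,
    (measurePreserving_pairCoordinates b c).comp (measurePreserving_splitCoordinate i₀), ?_, ?_⟩
  · have := Fintype.card_subtype_compl (fun i => i = i₀)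
    have h0 : 0 < Fintype.card (Fin m ⊕ Fin n) := Fintype.card_pos_iff.2 ⟨i₀⟩
    simp only [Fintype.card_subtype_eq] at this
    have h2 : Fintype.card (Fin m ⊕ Fin n) = m + n := by simp
    simp only [ne_eq]
    omega
  · rw [LinearEquiv.trans_apply, ← hi]
    congr 1
    ext i
    by_cases h : i = i₀
    · simp [splitCoordinate, h]
    · simp [splitCoordinate, h]
  · intro z
    rw [pi_norm_le_iff_of_nonneg (norm_nonneg _)]
    intro i
    exact abs_pairCoordinates_symm_le b c z i

section LevelSets

variable {m n : ℕ}

lemma mean_value_ball {R : E m n → ℝ} (hR : ContDiff ℝ 1 R) {a z z' : E m n} {s : ℝ}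
    (hz : z ∈ Metric.ball a s) (hz' : z' ∈ Metric.ball a s) :
    ∃ w ∈ Metric.ball a s, R z' - R z = fderiv ℝ R w (z' - z) := by
  obtain ⟨w, hw, h⟩ := domain_mvt (f := R) (f' := fderiv ℝ R) (s := Metric.ball a s) (x := z)
    (y := z') (fun x _ => ((hR.differentiable one_ne_zero) x).hasFDerivAt.hasFDerivWithinAt)
    (convex_ball a s) hz hz'
  exact ⟨w, (convex_ball a s).segment_subset hz hz' hw, h⟩

lemma add_mul_le_of_fderiv_ge {R : E m n → ℝ} (hR : ContDiff ℝ 1 R) {a e z : E m n} {s c₀ τ : ℝ}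
    (hN : ∀ z ∈ Metric.ball a s, c₀ ≤ fderiv ℝ R z e) (hz : z ∈ Metric.ball a s)
    (hz' : z + τ • e ∈ Metric.ball a s) (hτ : 0 ≤ τ) :
    R z + c₀ * τ ≤ R (z + τ • e) := by
  obtain ⟨w, hw, h⟩ := mean_value_ball hR hz hz'
  rw [add_sub_cancel_left, map_smul, smul_eq_mul] at h
  nlinarith [hN w hw]

/-- The volume of a thin one-sided shell around a level set of `R`, weighted by a nonnegative
function supported near a point with nonvanishing gradient, is controlled by the Hausdorff
measure on the level set. -/
lemma lintegral_shell_le_of_tsupport_subset {R : E m n → ℝ} (hR : ContDiff ℝ 1 R) {a e : E m n}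
    (he : (‖e.1‖ = 1 ∧ e.2 = 0) ∨ (e.1 = 0 ∧ ‖e.2‖ = 1)) {s c₀ : ℝ} (hc₀ : 0 < c₀)
    (hN : ∀ z ∈ Metric.ball a s, c₀ ≤ fderiv ℝ R z e) {f : E m n → ℝ} (hf : Continuous f)
    (hfc : HasCompactSupport f) (hfs : tsupport f ⊆ Metric.ball a s) (c : ℝ)
    {η : ENNReal} (hη : η ≠ 0) :
    ∀ᶠ ε : ℝ in nhdsWithin 0 (Set.Ioi 0),
      ∫⁻ z in {z | c - ε < R z ∧ R z < c}, ENNReal.ofReal (f z) ≤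
        ENNReal.ofReal (ε / c₀) *
          ((∫⁻ z in {z | R z = c}, ENNReal.ofReal (f z) ∂μH[(m + n - 1 : ℝ)]) + η) := by
  obtain ⟨J, hJ, Φ, hcard, hΦ, hΦe, hΦn⟩ := exists_adapted_coordinates e he
  have hRc : Continuous R := hR.continuous
  have hdim : ((m : ℝ) + n - 1) = Fintype.card J := by
    have : ((Fintype.card J + 1 : ℕ) : ℝ) = ((m + n : ℕ) : ℝ) := by rw [hcard]
    push_cast at this
    linarith
  set P : E m n → (J → ℝ) := fun z => (Φ.symm z).1 with hP
  have hPlip : LipschitzWith 1 P := by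
    refine LipschitzWith.of_dist_le_mul fun x y => ?_
    have : P x - P y = (Φ.symm (x - y)).1 := by simp [P]
    rw [dist_eq_norm, this, dist_eq_norm]
    simpa using hΦn (x - y)
  have hPadd : ∀ (z : E m n) (τ : ℝ), P (z + τ • e) = P z := by
    intro z τ
    have : Φ.symm e = (0, 1) := by rw [← hΦe, LinearEquiv.symm_apply_apply]
    simp [P, this]
  have hPΦ : ∀ p t, P (Φ (p, t)) = p := by intro p t; simp [P]
  have hline : ∀ z z', P z = P z' → ∃ τ : ℝ, z' = z + τ • e := by
    intro z z' h
    refine ⟨(Φ.symm z').2 - (Φ.symm z).2, ?_⟩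
    apply Φ.symm.injective
    have : Φ.symm e = (0, 1) := by rw [← hΦe, LinearEquiv.symm_apply_apply]
    rw [map_add, map_smul, this]
    ext i
    · have := congrFun h i
      simp only [P] at this
      simp [this]
    · simp
  have hline' : ∀ p t t', Φ (p, t') = Φ (p, t) + (t' - t) • e := by
    intro p t t'
    rw [← hΦe, ← map_smul, ← map_add]
    simp
  have hinj : ∀ z ∈ Metric.ball a s, ∀ z' ∈ Metric.ball a s, P z = P z' → R z = R z' → z = z' := by
    intro z hz z' hz' h1 h2
    obtain ⟨τ, rfl⟩ := hline z z' h1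
    obtain ⟨w, hw, h⟩ := mean_value_ball hR hz hz'
    rw [add_sub_cancel_left, map_smul, smul_eq_mul, h2, sub_self] at h
    have := hN w hw
    rcases mul_eq_zero.1 h.symm with h0 | h0
    · simp [h0]
    · linarith
  have hnorm : ‖e‖ = 1 := by
    rcases he with ⟨h1, h2⟩ | ⟨h1, h2⟩ <;> simp [Prod.norm_def, h1, h2]
  obtain ⟨δ, hδ, hδs⟩ := IsCompact.exists_cthickening_subset_open hfc Metric.isOpen_ball hfs
  set C' := Metric.cthickening δ (tsupport f) with hC'
  have hC'c : IsCompact C' := IsCompact.cthickening hfc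
  have hSc : IsCompact ({z | R z = c} ∩ C') :=
    hC'c.inter_left (isClosed_eq hRc continuous_const)
  set Y := P '' ({z | R z = c} ∩ C') with hY
  have hYc : IsCompact Y := hSc.image hPlip.continuous
  have hYv : volume Y ≠ ⊤ := hYc.measure_lt_top.ne
  obtain ⟨η₁, hη₁, hη₁'⟩ : ∃ η₁ : ℝ, 0 < η₁ ∧ ENNReal.ofReal η₁ * volume Y ≤ η := by
    rcases eq_or_ne η ⊤ with h | h
    · exact ⟨1, one_pos, by simp [h]⟩
    · refine ⟨η.toReal / ((volume Y).toReal + 1), ?_, ?_⟩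
      · have := ENNReal.toReal_pos hη h
        positivity
      · rw [← ENNReal.ofReal_toReal hYv, ← ENNReal.ofReal_mul (by positivity)]
        rw [ENNReal.ofReal_le_iff_le_toReal h, div_mul_eq_mul_div, div_le_iff₀ (by positivity)]
        rw [ENNReal.toReal_ofReal (by positivity)]
        nlinarith [ENNReal.toReal_nonneg (a := η), ENNReal.toReal_nonneg (a := volume Y)]
  obtain ⟨δ₂, hδ₂, hfδ⟩ := Metric.uniformContinuous_iff.1
    (hfc.uniformContinuous_of_continuous hf) η₁ hη₁
  have hsmall : ∀ᶠ ε : ℝ in nhdsWithin 0 (Set.Ioi 0), ε < c₀ * min δ δ₂ :=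
    nhdsWithin_le_nhds (eventually_lt_nhds (by positivity))
  filter_upwards [hsmall, self_mem_nhdsWithin] with ε hε hε0
  replace hε0 : 0 < ε := hε0
  have hε1 : ε / c₀ < min δ δ₂ := by rw [div_lt_iff₀ hc₀]; linarith
  have hεδ : ε / c₀ < δ := hε1.trans_le (min_le_left _ _)
  have hεδ₂ : ε / c₀ < δ₂ := hε1.trans_le (min_le_right _ _)
  -- moving a point of the shell along `e` onto the level set
  have hmove : ∀ z ∈ tsupport f, c - ε < R z → R z < c →
      ∃ z' ∈ {z | R z = c} ∩ C', P z' = P z ∧ f z ≤ f z' + η₁ := by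
    intro z hz h1 h2
    have hmem : ∀ τ ∈ Set.Icc 0 (ε / c₀), z + τ • e ∈ C' := by
      intro τ hτ
      refine Metric.mem_cthickening_of_dist_le _ z δ _ hz ?_
      rw [dist_eq_norm, add_sub_cancel_left, norm_smul, hnorm, mul_one, Real.norm_eq_abs,
        abs_of_nonneg hτ.1]
      exact hτ.2.trans hεδ.le
    have hpos : 0 ≤ ε / c₀ := by positivity
    have hend : c ≤ R (z + (ε / c₀) • e) := by
      have := add_mul_le_of_fderiv_ge hR hN (hfs hz) (hδs (hmem _ ⟨hpos, le_rfl⟩)) hpos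
      rw [mul_div_cancel₀ _ hc₀.ne'] at this
      linarith
    have hcont : ContinuousOn (fun τ : ℝ => R (z + τ • e)) (Set.Icc 0 (ε / c₀)) := by
      fun_prop
    obtain ⟨τ, hτ, hτc⟩ := intermediate_value_Icc hpos hcont
      (show c ∈ Set.Icc _ _ from ⟨by simpa using h2.le, hend⟩)
    refine ⟨z + τ • e, ⟨hτc, hmem τ hτ⟩, hPadd z τ, ?_⟩
    have hd : dist z (z + τ • e) < δ₂ := by
      rw [dist_comm, dist_eq_norm, add_sub_cancel_left, norm_smul, hnorm, mul_one,
        Real.norm_eq_abs, abs_of_nonneg hτ.1]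
      exact hτ.2.trans_lt hεδ₂
    have := hfδ hd
    rw [Real.dist_eq] at this
    linarith [le_abs_self (f z - f (z + τ • e))]
  choose! σ hσ using fun p (hp : p ∈ Y) => hp
  set A : Set (E m n) := {z | c - ε < R z ∧ R z < c} with hA
  have hAm : MeasurableSet A :=
    ((isOpen_lt continuous_const hRc).inter (isOpen_lt hRc continuous_const)).measurableSet
  set g : E m n → ENNReal := A.indicator fun z => ENNReal.ofReal (f z) with hg
  have hgm : Measurable g := (ENNReal.measurable_ofReal.comp hf.measurable).indicator hAm
  have hgmem : ∀ z, g z ≠ 0 → z ∈ A ∧ z ∈ tsupport f := by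
    intro z hz
    have h1 : z ∈ A := Set.mem_of_indicator_ne_zero hz
    refine ⟨h1, subset_tsupport _ fun h0 => hz ?_⟩
    simp [g, h0]
  have hfiber : ∀ p, ∫⁻ t, g (Φ (p, t)) ≤
      Y.indicator (fun p => ENNReal.ofReal (ε / c₀) *
        (ENNReal.ofReal (f (σ p)) + ENNReal.ofReal η₁)) p := by
    intro p
    by_cases hp : ∀ t, g (Φ (p, t)) = 0
    · simp [hp]
    · push Not at hp
      obtain ⟨t₀, ht₀⟩ := hp
      have hstep : ∀ t, g (Φ (p, t)) ≠ 0 → p ∈ Y ∧ f (Φ (p, t)) ≤ f (σ p) + η₁ := by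
        intro t ht
        obtain ⟨⟨hA1, hA2⟩, hts⟩ := hgmem _ ht
        obtain ⟨z', hz', hPz', hfz'⟩ := hmove _ hts hA1 hA2
        rw [hPΦ] at hPz'
        have hpY : p ∈ Y := ⟨z', hz', hPz'⟩
        have hσp := hσ p hpY
        have : z' = σ p := hinj _ (hδs hz'.2) _ (hδs hσp.1.2) (by rw [hPz', hσp.2])
          (by rw [hz'.1, hσp.1.1])
        exact ⟨hpY, this ▸ hfz'⟩
      rw [Set.indicator_of_mem (hstep t₀ ht₀).1]
      set T : Set ℝ := {t | g (Φ (p, t)) ≠ 0} with hT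
      have hTv : volume T ≤ ENNReal.ofReal (ε / c₀) := by
        refine (Real.volume_le_diam T).trans (Metric.ediam_le ?_)
        have key : ∀ t ∈ T, ∀ t' ∈ T, t ≤ t' → t' - t ≤ ε / c₀ := by
          intro t ht t' ht' htt
          obtain ⟨⟨h1, h2⟩, h3⟩ := hgmem _ ht
          obtain ⟨⟨h1', h2'⟩, h3'⟩ := hgmem _ ht'
          rw [hline' p t t'] at h1' h2' h3'
          have := add_mul_le_of_fderiv_ge hR hN (hfs h3) (hfs h3') (sub_nonneg.2 htt)
          rw [le_div_iff₀ hc₀]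
          linarith
        intro t ht t' ht'
        rw [edist_dist]
        refine ENNReal.ofReal_le_ofReal ?_
        rw [Real.dist_eq]
        rcases le_total t t' with h | h
        · rw [abs_of_nonpos (by linarith)]
          linarith [key t ht t' ht' h]
        · rw [abs_of_nonneg (by linarith)]
          exact key t' ht' t ht h
      calc ∫⁻ t, g (Φ (p, t))
          ≤ ∫⁻ t, T.indicator
            (fun _ => ENNReal.ofReal (f (σ p)) + ENNReal.ofReal η₁) t := by
            refine lintegral_mono fun t => ?_
            by_cases ht : g (Φ (p, t)) = 0
            · simp [ht]
            · rw [Set.indicator_of_mem (show t ∈ T from ht)]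
              have h1 := hstep t ht
              rw [hg, Set.indicator_of_mem (hgmem _ ht).1]
              exact (ENNReal.ofReal_le_ofReal h1.2).trans ENNReal.ofReal_add_le
        _ ≤ (ENNReal.ofReal (f (σ p)) + ENNReal.ofReal η₁) * volume T :=
            lintegral_indicator_const_le _ _
        _ ≤ _ := by rw [mul_comm]; gcongr
  have hproj : volume.restrict Y ≤ Measure.map P
      ((μH[(m + n - 1 : ℝ)]).restrict ({z | R z = c} ∩ C')) := by
    refine Measure.le_iff.2 fun B hB => ?_
    rw [Measure.restrict_apply hB, Measure.map_apply hPlip.continuous.measurable hB,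
      Measure.restrict_apply (hPlip.continuous.measurable hB)]
    have hBY : B ∩ Y = P '' (P ⁻¹' B ∩ ({z | R z = c} ∩ C')) := by
      rw [Set.image_preimage_inter]
    rw [hBY, hdim, ← hausdorffMeasure_pi_real]
    simpa using hPlip.hausdorffMeasure_image_le (Nat.cast_nonneg (Fintype.card J))
      (P ⁻¹' B ∩ ({z | R z = c} ∩ C'))
  have hsurf : ∫⁻ p in Y, ENNReal.ofReal (f (σ p)) ≤
      ∫⁻ z in {z | R z = c}, ENNReal.ofReal (f z) ∂μH[(m + n - 1 : ℝ)] := by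
    calc ∫⁻ p in Y, ENNReal.ofReal (f (σ p))
        ≤ ∫⁻ p, ENNReal.ofReal (f (σ p)) ∂(Measure.map P
          ((μH[(m + n - 1 : ℝ)]).restrict ({z | R z = c} ∩ C'))) := lintegral_mono' hproj le_rfl
      _ ≤ ∫⁻ z in {z | R z = c} ∩ C', ENNReal.ofReal (f (σ (P z))) ∂μH[(m + n - 1 : ℝ)] :=
          lintegral_map_le _ _
      _ = ∫⁻ z in {z | R z = c} ∩ C', ENNReal.ofReal (f z) ∂μH[(m + n - 1 : ℝ)] := by
          refine setLIntegral_congr_fun hSc.measurableSet fun z hz => ?_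
          have hσp := hσ (P z) ⟨z, hz, rfl⟩
          have : σ (P z) = z := hinj _ (hδs hσp.1.2) _ (hδs hz.2) hσp.2
            (hσp.1.1.trans hz.1.symm)
          simp only [this]
      _ ≤ _ := lintegral_mono_set Set.inter_subset_left
  calc ∫⁻ z in A, ENNReal.ofReal (f z) = ∫⁻ z, g z := (lintegral_indicator hAm _).symm
    _ = ∫⁻ q, g (Φ q) := (hΦ.lintegral_comp hgm).symm
    _ = ∫⁻ p, ∫⁻ t, g (Φ (p, t)) := by
        rw [Measure.volume_eq_prod, lintegral_prod]
        exact (hgm.comp hΦ.measurable).aemeasurable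
    _ ≤ ∫⁻ p, Y.indicator (fun p => ENNReal.ofReal (ε / c₀) *
        (ENNReal.ofReal (f (σ p)) + ENNReal.ofReal η₁)) p := lintegral_mono hfiber
    _ = ENNReal.ofReal (ε / c₀) *
        ((∫⁻ p in Y, ENNReal.ofReal (f (σ p))) + ENNReal.ofReal η₁ * volume Y) := by
        rw [lintegral_indicator hYc.measurableSet, lintegral_const_mul' _ _ ENNReal.ofReal_ne_top,
          lintegral_add_right _ measurable_const, setLIntegral_const]
    _ ≤ _ := by gcongr

/-- Level sets of `R` have finite Hausdorff measure near points with nonvanishing gradient. -/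
lemma hausdorffMeasure_levelSet_inter_ball_lt_top {R : E m n → ℝ} (hR : ContDiff ℝ 1 R)
    {a e : E m n} (he : (‖e.1‖ = 1 ∧ e.2 = 0) ∨ (e.1 = 0 ∧ ‖e.2‖ = 1)) {s c₀ M : ℝ} (hc₀ : 0 < c₀)
    (hN : ∀ z ∈ Metric.ball a s, c₀ ≤ fderiv ℝ R z e)
    (hM : ∀ z ∈ Metric.ball a s, ‖fderiv ℝ R z‖ ≤ M) (c : ℝ) :
    μH[(m + n - 1 : ℝ)] ({z | R z = c} ∩ Metric.ball a s) < ⊤ := by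
  obtain ⟨J, hJ, Φ, hcard, hΦ, hΦe, hΦn⟩ := exists_adapted_coordinates e he
  have hdim : ((m : ℝ) + n - 1) = Fintype.card J := by
    have : ((Fintype.card J + 1 : ℕ) : ℝ) = ((m + n : ℕ) : ℝ) := by rw [hcard]
    push_cast at this
    linarith
  set P : E m n → (J → ℝ) := fun z => (Φ.symm z).1 with hP
  have hPlip : LipschitzWith 1 P := by
    refine LipschitzWith.of_dist_le_mul fun x y => ?_
    have : P x - P y = (Φ.symm (x - y)).1 := by simp [P]
    rw [dist_eq_norm, this, dist_eq_norm]
    simpa using hΦn (x - y)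
  set S := {z | R z = c} ∩ Metric.ball a s with hS
  set L : (J → ℝ) →L[ℝ] E m n :=
    LinearMap.toContinuousLinearMap (Φ.toLinearMap.comp (LinearMap.inl ℝ (J → ℝ) ℝ)) with hL
  have hdecomp : ∀ v : E m n, v = L (Φ.symm v).1 + (Φ.symm v).2 • e := by
    intro v
    have h1 : L (Φ.symm v).1 = Φ ((Φ.symm v).1, 0) := rfl
    rw [h1, ← hΦe, ← map_smul, ← map_add]
    simp
  have hnorm : ‖e‖ = 1 := by
    rcases he with ⟨h1, h2⟩ | ⟨h1, h2⟩ <;> simp [Prod.norm_def, h1, h2]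
  have hanti : ∀ z ∈ S, ∀ z' ∈ S, dist z z' ≤ (‖L‖ + |M| * ‖L‖ / c₀) * dist (P z) (P z') := by
    intro z hz z' hz'
    obtain ⟨w, hw, h⟩ := mean_value_ball hR hz'.2 hz.2
    have hz1 : R z = c := hz.1
    have hz2 : R z' = c := hz'.1
    rw [hz1, hz2, sub_self] at h
    set v := z - z' with hv
    have hPv : dist (P z) (P z') = ‖(Φ.symm v).1‖ := by
      rw [dist_eq_norm]
      simp [P, v]
    rw [hPv, dist_eq_norm, ← hv]
    have h2 : fderiv ℝ R w v = fderiv ℝ R w (L (Φ.symm v).1) + (Φ.symm v).2 * fderiv ℝ R w e := by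
      conv_lhs => rw [hdecomp v]
      rw [map_add, map_smul, smul_eq_mul]
    have h3 : |fderiv ℝ R w (L (Φ.symm v).1)| ≤ |M| * (‖L‖ * ‖(Φ.symm v).1‖) := by
      calc |fderiv ℝ R w (L (Φ.symm v).1)| ≤ ‖fderiv ℝ R w‖ * ‖L (Φ.symm v).1‖ :=
            (fderiv ℝ R w).le_opNorm _
        _ ≤ _ := by
          gcongr
          · exact (hM w hw).trans (le_abs_self M)
          · exact L.le_opNorm _
    have h4 : |(Φ.symm v).2| * c₀ ≤ |M| * (‖L‖ * ‖(Φ.symm v).1‖) := by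
      have h5 : (Φ.symm v).2 * fderiv ℝ R w e = - fderiv ℝ R w (L (Φ.symm v).1) := by linarith
      calc |(Φ.symm v).2| * c₀ ≤ |(Φ.symm v).2| * |fderiv ℝ R w e| := by
            gcongr
            exact (hN w hw).trans (le_abs_self _)
        _ = |fderiv ℝ R w (L (Φ.symm v).1)| := by rw [← abs_mul, h5, abs_neg]
        _ ≤ _ := h3
    have h6 : |(Φ.symm v).2| ≤ |M| * ‖L‖ / c₀ * ‖(Φ.symm v).1‖ := by
      rw [div_mul_eq_mul_div, le_div_iff₀ hc₀]
      linarith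
    calc ‖v‖ = ‖L (Φ.symm v).1 + (Φ.symm v).2 • e‖ := by rw [← hdecomp v]
      _ ≤ ‖L (Φ.symm v).1‖ + ‖(Φ.symm v).2 • e‖ := norm_add_le _ _
      _ ≤ ‖L‖ * ‖(Φ.symm v).1‖ + |M| * ‖L‖ / c₀ * ‖(Φ.symm v).1‖ := by
        gcongr
        · exact L.le_opNorm _
        · rw [norm_smul, hnorm, mul_one]
          exact h6
      _ = _ := by ring
  set K : NNReal := ⟨‖L‖ + |M| * ‖L‖ / c₀, by positivity⟩ with hK
  have hanti' : AntilipschitzWith K (S.domRestrict P) := by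
    refine AntilipschitzWith.of_le_mul_dist fun x y => ?_
    exact hanti x x.2 y y.2
  have h1 := hanti'.le_hausdorffMeasure_image (Nat.cast_nonneg (Fintype.card J)) Set.univ
  have h2 : μH[(Fintype.card J : ℝ)] S = μH[(Fintype.card J : ℝ)] (Set.univ : Set S) := by
    have := (isometry_subtype_coe (s := S)).hausdorffMeasure_image
      (d := (Fintype.card J : ℝ)) (Or.inl (Nat.cast_nonneg _)) Set.univ
    simpa using this
  rw [hdim, h2]
  refine h1.trans_lt (ENNReal.mul_lt_top ?_ ?_)
  · exact ENNReal.rpow_lt_top_of_nonneg (Nat.cast_nonneg _) ENNReal.coe_ne_top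
  · rw [hausdorffMeasure_pi_real]
    have hsub : S.domRestrict P '' Set.univ ⊆ P '' Metric.closedBall a s := by
      rintro _ ⟨x, -, rfl⟩
      exact ⟨x, Metric.ball_subset_closedBall x.2.2, rfl⟩
    exact (measure_mono hsub).trans_lt
      ((isCompact_closedBall a s).image hPlip.continuous).measure_lt_top

end LevelSets

section Shell

variable {m n : ℕ}

/-- Euclidean norm of the full gradient of a function on the product space. -/
def gradNorm (f : E m n → ℝ) (z : E m n) : ℝ :=
  Real.sqrt ((∑ i, (fderiv ℝ f z (EuclideanSpace.single i 1, 0))^2)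
    + (∑ j, (fderiv ℝ f z (0, EuclideanSpace.single j 1))^2))

lemma apply_fst_eq_sum (L : E m n →L[ℝ] ℝ) (v : EuclideanSpace ℝ (Fin m)) :
    L (v, 0) = ∑ i, v i * L (EuclideanSpace.single i 1, 0) := by
  have h := (EuclideanSpace.basisFun (Fin m) ℝ).sum_repr v
  have : L (v, 0) = (L.comp (ContinuousLinearMap.inl ℝ _ _)) v := rfl
  rw [this]
  conv_lhs => rw [← h, map_sum]
  refine Finset.sum_congr rfl fun i _ => ?_
  rw [map_smul]
  simp

lemma apply_snd_eq_sum (L : E m n →L[ℝ] ℝ) (v : EuclideanSpace ℝ (Fin n)) :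
    L (0, v) = ∑ j, v j * L (0, EuclideanSpace.single j 1) := by
  have h := (EuclideanSpace.basisFun (Fin n) ℝ).sum_repr v
  have : L (0, v) = (L.comp (ContinuousLinearMap.inr ℝ _ _)) v := rfl
  rw [this]
  conv_lhs => rw [← h, map_sum]
  refine Finset.sum_congr rfl fun i _ => ?_
  rw [map_smul]
  simp

lemma eq_zero_of_sum_sq_eq_zero (L : E m n →L[ℝ] ℝ)
    (h : (∑ i, (L (EuclideanSpace.single i 1, 0))^2)
      + (∑ j, (L (0, EuclideanSpace.single j 1))^2) = 0) : L = 0 := by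
  have h1 : 0 ≤ ∑ i, (L (EuclideanSpace.single i 1, 0))^2 := by positivity
  have h2 : 0 ≤ ∑ j, (L (0, EuclideanSpace.single j 1))^2 := by positivity
  have h3 : ∑ i, (L (EuclideanSpace.single i 1, 0))^2 = 0 := by linarith
  have h4 : ∑ j, (L (0, EuclideanSpace.single j 1))^2 = 0 := by linarith
  rw [Finset.sum_eq_zero_iff_of_nonneg (fun i _ => sq_nonneg _)] at h3 h4
  ext z
  · simp only [ContinuousLinearMap.comp_apply, ContinuousLinearMap.inl_apply]
    rw [apply_fst_eq_sum]
    refine (Finset.sum_eq_zero fun i hi => ?_).trans rfl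
    rw [pow_eq_zero_iff two_ne_zero |>.1 (h3 i hi), mul_zero]
  · simp only [ContinuousLinearMap.comp_apply, ContinuousLinearMap.inr_apply]
    rw [apply_snd_eq_sum]
    refine (Finset.sum_eq_zero fun i hi => ?_).trans rfl
    rw [pow_eq_zero_iff two_ne_zero |>.1 (h4 i hi), mul_zero]

lemma gradNorm_pos {f : E m n → ℝ} {z : E m n} (h : fderiv ℝ f z ≠ 0) : 0 < gradNorm f z := by
  refine Real.sqrt_pos.2 (lt_of_le_of_ne (by positivity) fun h0 => h ?_)
  exact eq_zero_of_sum_sq_eq_zero _ h0.symm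

lemma continuous_gradNorm {f : E m n → ℝ} (hf : ContDiff ℝ 1 f) : Continuous (gradNorm f) := by
  have := hf.continuous_fderiv one_ne_zero
  unfold gradNorm
  fun_prop

/-- Either factor direction captures the gradient up to the factor `√2 < 3/2`. -/
lemma exists_unit_direction (L : E m n →L[ℝ] ℝ) (hL : L ≠ 0) :
    ∃ e : E m n, ((‖e.1‖ = 1 ∧ e.2 = 0) ∨ (e.1 = 0 ∧ ‖e.2‖ = 1)) ∧
      Real.sqrt ((∑ i, (L (EuclideanSpace.single i 1, 0))^2)
        + (∑ j, (L (0, EuclideanSpace.single j 1))^2)) < 3 / 2 * L e := by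
  set A := ∑ i, (L (EuclideanSpace.single i 1, 0))^2 with hA
  set B := ∑ j, (L (0, EuclideanSpace.single j 1))^2 with hB
  have hA0 : 0 ≤ A := by positivity
  have hB0 : 0 ≤ B := by positivity
  have hAB : A + B ≠ 0 := fun h => hL (eq_zero_of_sum_sq_eq_zero L h)
  have key : ∀ x y : ℝ, 0 ≤ y → y ≤ x → x + y ≠ 0 → Real.sqrt (x + y) < 3 / 2 * Real.sqrt x := by
    intro x y hy hxy h
    have hx : 0 < x := by
      rcases (hy.trans hxy).lt_or_eq with h1 | h1
      · exact h1
      · exact absurd (by linarith) h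
    rw [Real.sqrt_lt' (by positivity), mul_pow, Real.sq_sqrt hx.le]
    linarith
  rcases le_total B A with h | h
  · set v : EuclideanSpace ℝ (Fin m) :=
      WithLp.toLp 2 (fun i => L (EuclideanSpace.single i 1, 0)) with hv
    have hvn : ‖v‖ = Real.sqrt A := by
      rw [EuclideanSpace.norm_eq]
      simp [v, A]
    have hA' : 0 < Real.sqrt A := by
      have := key A B hB0 h hAB
      have := Real.sqrt_nonneg (A + B)
      linarith
    have hLv : L (v, 0) = A := by
      rw [apply_fst_eq_sum]
      refine Finset.sum_congr rfl fun i _ => ?_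
      simp [v, sq]
    refine ⟨(‖v‖⁻¹ • v, 0), Or.inl ⟨?_, rfl⟩, ?_⟩
    · rw [norm_smul, norm_inv, norm_norm, inv_mul_cancel₀ (by rw [hvn]; exact hA'.ne')]
    · have : ((‖v‖⁻¹ • v, 0) : E m n) = ‖v‖⁻¹ • (v, 0) := by simp
      rw [this, map_smul, hLv, hvn, smul_eq_mul]
      have h2 : (Real.sqrt A)⁻¹ * A = Real.sqrt A := by
        rw [inv_mul_eq_div, Real.div_sqrt]
      rw [h2]
      exact key A B hB0 h hAB
  · set v : EuclideanSpace ℝ (Fin n) :=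
      WithLp.toLp 2 (fun i => L (0, EuclideanSpace.single i 1)) with hv
    have hvn : ‖v‖ = Real.sqrt B := by
      rw [EuclideanSpace.norm_eq]
      simp [v, B]
    have hk := key B A hA0 h (by rwa [add_comm])
    have hB' : 0 < Real.sqrt B := by
      have := Real.sqrt_nonneg (B + A)
      linarith
    have hLv : L (0, v) = B := by
      rw [apply_snd_eq_sum]
      refine Finset.sum_congr rfl fun i _ => ?_
      simp [v, sq]
    refine ⟨(0, ‖v‖⁻¹ • v), Or.inr ⟨rfl, ?_⟩, ?_⟩
    · rw [norm_smul, norm_inv, norm_norm, inv_mul_cancel₀ (by rw [hvn]; exact hB'.ne')]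
    · have : ((0, ‖v‖⁻¹ • v) : E m n) = ‖v‖⁻¹ • (0, v) := by simp
      rw [this, map_smul, hLv, hvn, smul_eq_mul]
      have h2 : (Real.sqrt B)⁻¹ * B = Real.sqrt B := by
        rw [inv_mul_eq_div, Real.div_sqrt]
      rw [h2, add_comm]
      exact hk

/-- Uniform transversality of a coordinate-type direction near a noncritical point. -/
lemma exists_transversal_ball {R : E m n → ℝ} (hR : ContDiff ℝ 1 R) {V : Set (E m n)}
    (hV : IsOpen V) {a : E m n} (haV : a ∈ V) (ha : fderiv ℝ R a ≠ 0) :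
    ∃ (e : E m n) (s c₀ M : ℝ), ((‖e.1‖ = 1 ∧ e.2 = 0) ∨ (e.1 = 0 ∧ ‖e.2‖ = 1)) ∧ 0 < s ∧ 0 < c₀ ∧
      Metric.ball a s ⊆ V ∧ ∀ z ∈ Metric.ball a s,
        c₀ ≤ fderiv ℝ R z e ∧ ‖fderiv ℝ R z‖ ≤ M ∧ gradNorm R z < 3 / 2 * c₀ := by
  obtain ⟨e, he, hlt⟩ := exists_unit_direction _ ha
  have hgp := gradNorm_pos ha
  have hlt' : gradNorm R a < 3 / 2 * fderiv ℝ R a e := hlt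
  obtain ⟨c₀, h1, h2⟩ := exists_between
    (show gradNorm R a / (3 / 2) < fderiv ℝ R a e by rw [div_lt_iff₀ (by norm_num)]; linarith)
  rw [div_lt_iff₀ (by norm_num)] at h1
  have hcd := hR.continuous_fderiv one_ne_zero
  have ev1 : ∀ᶠ z in nhds a, c₀ < fderiv ℝ R z e :=
    (by fun_prop : Continuous fun z => fderiv ℝ R z e).continuousAt.eventually_const_lt h2
  have ev2 : ∀ᶠ z in nhds a, ‖fderiv ℝ R z‖ < ‖fderiv ℝ R a‖ + 1 :=
    hcd.norm.continuousAt.eventually_lt_const (lt_add_one _)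
  have ev3 : ∀ᶠ z in nhds a, gradNorm R z < c₀ * (3 / 2) :=
    (continuous_gradNorm hR).continuousAt.eventually_lt_const h1
  obtain ⟨s, hs, hball⟩ := Metric.eventually_nhds_iff_ball.1
    (ev1.and (ev2.and (ev3.and (hV.eventually_mem haV))))
  refine ⟨e, s, c₀, ‖fderiv ℝ R a‖ + 1, he, hs, by linarith, fun z hz => (hball z hz).2.2.2,
    fun z hz => ⟨(hball z hz).1.le, (hball z hz).2.1.le, ?_⟩⟩
  linarith [(hball z hz).2.2.1]

/-- One-sided thin-shell estimate around a compact noncritical level set. -/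
lemma lintegral_shell_le {R : E m n → ℝ} (hR : ContDiff ℝ 1 R) {b c : ℝ} (hbc : b < c)
    (hK : IsCompact {z | b ≤ R z ∧ R z ≤ c})
    (hgrad : ∀ z, b ≤ R z → R z ≤ c → fderiv ℝ R z ≠ 0) {V : Set (E m n)} (hV : IsOpen V)
    (hKV : {z | b ≤ R z ∧ R z ≤ c} ⊆ V) {H : E m n → ℝ} (hH : ContinuousOn H V)
    {η : ENNReal} (hη : η ≠ 0) :
    ∀ᶠ ε : ℝ in nhdsWithin 0 (Set.Ioi 0),
      ∫⁻ z in {z | c - ε < R z ∧ R z < c}, ENNReal.ofReal (H z) ≤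
        ENNReal.ofReal ε *
          ((∫⁻ z in {z | R z = c}, ENNReal.ofReal (3 / 2 * H z / gradNorm R z)
            ∂μH[(m + n - 1 : ℝ)]) + η) := by
  set K := {z | b ≤ R z ∧ R z ≤ c} with hKdef
  have hloc : ∀ a : K, ∃ (e : E m n) (s c₀ M : ℝ),
      ((‖e.1‖ = 1 ∧ e.2 = 0) ∨ (e.1 = 0 ∧ ‖e.2‖ = 1)) ∧ 0 < s ∧ 0 < c₀ ∧
      Metric.ball (a : E m n) s ⊆ V ∧ ∀ z ∈ Metric.ball (a : E m n) s,
        c₀ ≤ fderiv ℝ R z e ∧ ‖fderiv ℝ R z‖ ≤ M ∧ gradNorm R z < 3 / 2 * c₀ := fun a =>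
    exists_transversal_ball hR hV (hKV a.2) (hgrad a a.2.1 a.2.2)
  choose e s c₀ M he hs hc₀ hsV hball using hloc
  obtain ⟨t, ht⟩ := hK.elim_finite_subcover (fun a : K => Metric.ball (a : E m n) (s a))
    (fun a => Metric.isOpen_ball) fun z hz => Set.mem_iUnion.2 ⟨⟨z, hz⟩, Metric.mem_ball_self (hs _)⟩
  set N := t.card
  set p : Fin N → K := fun i => (t.equivFin.symm i : K) with hp
  have hcov : K ⊆ ⋃ i, Metric.ball (p i : E m n) (s (p i)) := by
    intro z hz
    obtain ⟨a, ha, hza⟩ := Set.mem_iUnion₂.1 (ht hz)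
    exact Set.mem_iUnion.2 ⟨t.equivFin ⟨a, ha⟩, by simpa [p] using hza⟩
  obtain ⟨g, hgs, hg1, hg01, hgc⟩ := exists_continuous_sum_one_of_isOpen_isCompact
    (s := fun i => Metric.ball (p i : E m n) (s (p i))) (fun i => Metric.isOpen_ball) hK hcov
  have hg1' : ∀ z ∈ K, ∑ i, ENNReal.ofReal (g i z) = 1 := by
    intro z hz
    rw [← ENNReal.ofReal_sum_of_nonneg fun i _ => (hg01 i z).1]
    have := hg1 hz
    simp only [Finset.sum_apply, Pi.one_apply] at this
    rw [this, ENNReal.ofReal_one]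
  have hgH : ∀ i, Continuous fun z => g i z * H z := by
    intro i
    refine continuous_of_tsupport fun z hz => ?_
    have hz' := hsV _ (hgs i (tsupport_mul_subset_left hz))
    exact (g i).continuous.continuousAt.mul (hH.continuousAt (hV.mem_nhds hz'))
  have hgm := (continuous_gradNorm hR).measurable
  have hloc : ∀ i, ∀ᶠ ε : ℝ in nhdsWithin 0 (Set.Ioi 0),
      ∫⁻ z in {z | c - ε < R z ∧ R z < c}, ENNReal.ofReal (g i z * H z) ≤
        ENNReal.ofReal (ε / c₀ (p i)) *
          ((∫⁻ z in {z | R z = c}, ENNReal.ofReal (g i z * H z) ∂μH[(m + n - 1 : ℝ)])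
            + ENNReal.ofReal (c₀ (p i)) * (η / (N + 1))) := by
    intro i
    refine lintegral_shell_le_of_tsupport_subset hR (he (p i)) (hc₀ (p i))
      (fun z hz => (hball _ z hz).1) (hgH i) ((hgc i).mul_right)
      (tsupport_mul_subset_left.trans (hgs i)) c ?_
    refine mul_ne_zero (by simpa using hc₀ (p i)) (ENNReal.div_ne_zero.2 ⟨hη, ?_⟩)
    exact_mod_cast ENNReal.natCast_ne_top (N + 1)
  have hsm : ∀ᶠ ε : ℝ in nhdsWithin 0 (Set.Ioi 0), ε < c - b :=
    nhdsWithin_le_nhds (eventually_lt_nhds (by linarith))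
  filter_upwards [Filter.eventually_all.2 hloc, hsm, self_mem_nhdsWithin] with ε hε hεb hε0
  replace hε0 : 0 < ε := hε0
  have hRc := hR.continuous
  have hAm : MeasurableSet {z | c - ε < R z ∧ R z < c} :=
    ((isOpen_lt continuous_const hRc).inter (isOpen_lt hRc continuous_const)).measurableSet
  have hSm : MeasurableSet {z | R z = c} := (isClosed_eq hRc continuous_const).measurableSet
  have hpt : ∀ i z, ENNReal.ofReal (1 / c₀ (p i)) * ENNReal.ofReal (g i z * H z) ≤
      ENNReal.ofReal (3 / 2 * (g i z * H z) / gradNorm R z) := by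
    intro i z
    rcases le_or_gt (g i z * H z) 0 with h | h
    · simp [ENNReal.ofReal_of_nonpos h]
    · have hz : z ∈ Metric.ball (p i : E m n) (s (p i)) :=
        hgs i (subset_tsupport _ fun h0 => by simp [h0] at h)
      obtain ⟨h1, -, h3⟩ := hball _ z hz
      have hc := hc₀ (p i)
      have hgp : 0 < gradNorm R z := gradNorm_pos fun h0 => by
        rw [h0] at h1
        simp only [_root_.zero_apply] at h1
        linarith
      rw [← ENNReal.ofReal_mul (by positivity)]
      refine ENNReal.ofReal_le_ofReal ?_
      rw [one_div_mul_eq_div, div_le_div_iff₀ hc hgp]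
      nlinarith
  calc ∫⁻ z in {z | c - ε < R z ∧ R z < c}, ENNReal.ofReal (H z)
      = ∫⁻ z in {z | c - ε < R z ∧ R z < c}, ∑ i, ENNReal.ofReal (g i z * H z) := by
        refine setLIntegral_congr_fun hAm fun z hz => ?_
        have hzK : z ∈ K := ⟨by have := hz.1; linarith, hz.2.le⟩
        simp only [ENNReal.ofReal_mul (hg01 _ z).1]
        rw [← Finset.sum_mul, hg1' z hzK, one_mul]
    _ = ∑ i, ∫⁻ z in {z | c - ε < R z ∧ R z < c}, ENNReal.ofReal (g i z * H z) :=
        lintegral_finsetSum _ fun i _ => (hgH i).measurable.ennreal_ofReal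
    _ ≤ ∑ i, ENNReal.ofReal (ε / c₀ (p i)) *
          ((∫⁻ z in {z | R z = c}, ENNReal.ofReal (g i z * H z) ∂μH[(m + n - 1 : ℝ)])
            + ENNReal.ofReal (c₀ (p i)) * (η / (N + 1))) := Finset.sum_le_sum fun i _ => hε i
    _ ≤ ∑ i, ENNReal.ofReal ε * ((∫⁻ z in {z | R z = c},
          ENNReal.ofReal (3 / 2 * (g i z * H z) / gradNorm R z) ∂μH[(m + n - 1 : ℝ)])
            + η / (N + 1)) := by
        refine Finset.sum_le_sum fun i _ => ?_
        have hc := hc₀ (p i)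
        rw [div_eq_mul_one_div, ENNReal.ofReal_mul hε0.le, mul_assoc, mul_add]
        gcongr
        · rw [← lintegral_const_mul' _ _ ENNReal.ofReal_ne_top]
          exact lintegral_mono (hpt i)
        · rw [← mul_assoc, ← ENNReal.ofReal_mul (by positivity), one_div_mul_cancel hc.ne',
            ENNReal.ofReal_one, one_mul]
    _ = ENNReal.ofReal ε * ((∫⁻ z in {z | R z = c},
          ∑ i, ENNReal.ofReal (3 / 2 * (g i z * H z) / gradNorm R z) ∂μH[(m + n - 1 : ℝ)])
            + N * (η / (N + 1))) := by
        rw [← Finset.mul_sum, Finset.sum_add_distrib, lintegral_finsetSum]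
        · simp
        · intro i _
          have := (hgH i).measurable
          exact ((this.const_mul _).div hgm).ennreal_ofReal
    _ ≤ _ := by
        refine mul_le_mul' le_rfl (add_le_add ?_ ?_)
        · refine (setLIntegral_congr_fun hSm fun z hz => ?_).le
          have hz' : R z = c := hz
          have hzK : z ∈ K := ⟨by rw [hz']; exact hbc.le, hz'.le⟩
          have : ∀ i, 3 / 2 * (g i z * H z) / gradNorm R z =
            g i z * (3 / 2 * H z / gradNorm R z) := fun i => by ring
          simp only [this, ENNReal.ofReal_mul (hg01 _ z).1]
          rw [← Finset.sum_mul, hg1' z hzK, one_mul]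
        · rw [← mul_div_assoc]
          refine ENNReal.div_le_of_le_mul ?_
          rw [mul_comm]
          gcongr
          exact le_self_add

/-- Compact noncritical level sets have finite Hausdorff measure. -/
lemma hausdorffMeasure_levelSet_lt_top {R : E m n → ℝ} (hR : ContDiff ℝ 1 R) {c : ℝ}
    (hK : IsCompact {z | R z = c}) (hgrad : ∀ z, R z = c → fderiv ℝ R z ≠ 0) :
    μH[(m + n - 1 : ℝ)] {z | R z = c} < ⊤ := by
  have hloc : ∀ a : {z | R z = c}, ∃ s, 0 < s ∧
      μH[(m + n - 1 : ℝ)] ({z | R z = c} ∩ Metric.ball (a : E m n) s) < ⊤ := by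
    intro a
    obtain ⟨e, s, c₀, M, he, hs, hc₀, -, hb⟩ :=
      exists_transversal_ball hR isOpen_univ (Set.mem_univ (a : E m n)) (hgrad a a.2)
    exact ⟨s, hs, hausdorffMeasure_levelSet_inter_ball_lt_top hR he hc₀ (fun z hz => (hb z hz).1)
      (fun z hz => (hb z hz).2.1) c⟩
  choose s hs hfin using hloc
  obtain ⟨t, ht⟩ := hK.elim_finite_subcover
    (fun a : {z | R z = c} => Metric.ball (a : E m n) (s a))
    (fun a => Metric.isOpen_ball) fun z hz => Set.mem_iUnion.2 ⟨⟨z, hz⟩, Metric.mem_ball_self (hs _)⟩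
  have hsub : {z | R z = c} ⊆ ⋃ a ∈ t, ({z | R z = c} ∩ Metric.ball (a : E m n) (s a)) := by
    intro z hz
    obtain ⟨a, ha, hza⟩ := Set.mem_iUnion₂.1 (ht hz)
    exact Set.mem_iUnion₂.2 ⟨a, ha, hz, hza⟩
  refine (measure_mono hsub).trans_lt ((measure_biUnion_finset_le _ _).trans_lt ?_)
  exact ENNReal.sum_lt_top.2 fun a _ => hfin a

end Shell

section Divergence

variable {m n : ℕ}

lemma isAddHaarMeasure_volume_prod : (volume : Measure (E m n)).IsAddHaarMeasure := by
  rw [Measure.volume_eq_prod]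
  infer_instance

lemma ofReal_integral_le_lintegral_ofReal {X : Type*} [MeasurableSpace X] {μ : Measure X}
    (f : X → ℝ) : ENNReal.ofReal (∫ x, f x ∂μ) ≤ ∫⁻ x, ENNReal.ofReal (f x) ∂μ := by
  by_cases hf : Integrable f μ
  · refine ENNReal.ofReal_le_of_le_toReal ?_
    rw [integral_eq_lintegral_pos_part_sub_lintegral_neg_part hf]
    exact sub_le_self _ ENNReal.toReal_nonneg
  · simp [integral_undef hf]

/-- A `C¹` decreasing step from `1` to `0` on `[0,1]` whose slope is close to `-1`. -/
lemma exists_cutoff_profile : ∃ κ κ' : ℝ → ℝ, (∀ s, HasDerivAt κ (κ' s) s) ∧ Continuous κ' ∧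
    (∀ s ≤ 0, κ s = 1) ∧ (∀ s, 1 ≤ s → κ s = 0) ∧ (∀ s, 0 ≤ κ s) ∧ (∀ s, κ s ≤ 1) ∧
    (∀ s, 0 ≤ - κ' s) ∧ (∀ s, - κ' s ≤ 7 / 6) ∧ (∀ s, s ∉ Set.Ioo (0 : ℝ) 1 → κ' s = 0) := by
  set φ : ℝ → ℝ := fun t => max 0 (1 - (2 * t - 1) ^ 12) with hφ
  have hφc : Continuous φ := by fun_prop
  have hφ0 : ∀ t, 0 ≤ φ t := fun t => le_max_left _ _
  have hφ1 : ∀ t, φ t ≤ 1 := fun t => max_le zero_le_one (by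
    have : 0 ≤ (2 * t - 1) ^ 12 := by positivity
    linarith)
  have hφs : ∀ t, t ∉ Set.Ioo (0 : ℝ) 1 → φ t = 0 := by
    intro t ht
    refine max_eq_left ?_
    have h1 : 1 ≤ (2 * t - 1) ^ 2 := by
      by_contra! h
      exact ht ⟨by nlinarith, by nlinarith⟩
    have h2 : 1 ≤ ((2 * t - 1) ^ 2) ^ 6 := one_le_pow₀ h1
    have h3 : ((2 * t - 1) ^ 2) ^ 6 = (2 * t - 1) ^ 12 := by ring
    linarith
  set Z := ∫ t in (0 : ℝ)..1, φ t with hZ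
  have hZle : 12 / 13 ≤ Z := by
    have h1 : ∫ t in (0 : ℝ)..1, (1 - (2 * t - 1) ^ 12) = 12 / 13 := by
      have : ∀ t : ℝ, HasDerivAt (fun t => t - (2 * t - 1) ^ 13 / 26) (1 - (2 * t - 1) ^ 12) t := by
        intro t
        have h := ((((hasDerivAt_id t).const_mul 2).sub_const 1).pow 13).div_const 26
        refine ((hasDerivAt_id t).sub h).congr_deriv ?_
        simp only [id_eq, Nat.cast_ofNat]
        ring
      rw [intervalIntegral.integral_eq_sub_of_hasDerivAt (fun t _ => this t)
        (by apply Continuous.intervalIntegrable; fun_prop)]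
      norm_num
    rw [← h1]
    refine intervalIntegral.integral_mono_on zero_le_one
      (by apply Continuous.intervalIntegrable; fun_prop) (hφc.intervalIntegrable _ _)
      fun t _ => le_max_right _ _
  have hZp : 0 < Z := by linarith
  have hadd : ∀ s, ∫ t in (0 : ℝ)..s, φ t = Z - ∫ t in s..1, φ t := by
    intro s
    rw [hZ, ← intervalIntegral.integral_add_adjacent_intervals (hφc.intervalIntegrable 0 s)
      (hφc.intervalIntegrable s 1)]
    ring
  have hle0 : ∀ s ≤ 0, ∫ t in (0 : ℝ)..s, φ t = 0 := by
    intro s hs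
    refine intervalIntegral.integral_zero_ae (Filter.Eventually.of_forall fun t ht => hφs t ?_)
    rw [Set.uIoc_of_ge hs] at ht
    exact fun h => absurd h.1 (not_lt.2 ht.2)
  have hge1 : ∀ s, 1 ≤ s → ∫ t in s..1, φ t = 0 := by
    intro s hs
    refine intervalIntegral.integral_zero_ae (Filter.Eventually.of_forall fun t ht => hφs t ?_)
    rw [Set.uIoc_of_ge hs] at ht
    exact fun h => absurd h.2 (not_lt.2 ht.1.le)
  have hnn : ∀ s, 0 ≤ ∫ t in (0 : ℝ)..s, φ t := by
    intro s
    rcases le_total 0 s with h | h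
    · exact intervalIntegral.integral_nonneg h fun t _ => hφ0 t
    · exact (hle0 s h).ge
  have hnn' : ∀ s, 0 ≤ ∫ t in s..1, φ t := by
    intro s
    rcases le_total s 1 with h | h
    · exact intervalIntegral.integral_nonneg h fun t _ => hφ0 t
    · exact (hge1 s h).ge
  refine ⟨fun s => 1 - (∫ t in (0 : ℝ)..s, φ t) / Z, fun s => - (φ s / Z), ?_, by fun_prop,
    ?_, ?_, ?_, ?_, ?_, ?_, ?_⟩
  · intro s
    simpa using ((intervalIntegral.integral_hasDerivAt_right (hφc.intervalIntegrable 0 s)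
      (hφc.stronglyMeasurableAtFilter _ _) hφc.continuousAt).div_const Z).const_sub 1
  · intro s hs
    simp [hle0 s hs]
  · intro s hs
    simp [hadd, hge1 s hs, hZp.ne']
  · intro s
    simp only [sub_nonneg]
    rw [div_le_one hZp, hadd]
    linarith [hnn' s]
  · intro s
    have := div_nonneg (hnn s) hZp.le
    simp only
    linarith
  · intro s
    rw [neg_neg]
    exact div_nonneg (hφ0 s) hZp.le
  · intro s
    rw [neg_neg, div_le_iff₀ hZp]
    linarith [hφ1 s]
  · intro s hs
    simp [hφs s hs]

/-- Divergence of a vector field on the product space. -/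
def divg (F : E m n → E m n) (z : E m n) : ℝ :=
  (∑ i, (fderiv ℝ F z (EuclideanSpace.single i 1, 0)).1 i)
    + ∑ j, (fderiv ℝ F z (0, EuclideanSpace.single j 1)).2 j

lemma integral_fderiv_apply_eq_zero {f : E m n → ℝ} (hf : ContDiff ℝ 1 f)
    (hc : HasCompactSupport f) (v : E m n) : ∫ z, fderiv ℝ f z v = 0 := by
  have := isAddHaarMeasure_volume_prod (m := m) (n := n)
  have hf' : Continuous fun z => fderiv ℝ f z v := by
    have := hf.continuous_fderiv one_ne_zero
    fun_prop
  have h := integral_mul_fderiv_eq_neg_fderiv_mul_of_integrable (μ := (volume : Measure (E m n)))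
    (f := fun _ => (1 : ℝ)) (g := f) (v := v) (by simp)
    (by simpa using hf'.integrable_of_hasCompactSupport (hc.fderiv_apply ℝ v))
    (by simpa using hf.continuous.integrable_of_hasCompactSupport hc)
    (fun z _ => by fun_prop) (fun z _ => hf.differentiable one_ne_zero z)
  simpa using h

lemma fderiv_fst_apply {F : E m n → E m n} {z : E m n} (hF : DifferentiableAt ℝ F z) (v : E m n)
    (i : Fin m) : (fderiv ℝ F z v).1 i = fderiv ℝ (fun w => (F w).1 i) z v := by
  have h := (((EuclideanSpace.proj i : EuclideanSpace ℝ (Fin m) →L[ℝ] ℝ).comp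
    (ContinuousLinearMap.fst ℝ (EuclideanSpace ℝ (Fin m))
      (EuclideanSpace ℝ (Fin n)))).hasFDerivAt (x := F z)).comp z hF.hasFDerivAt
  have h2 : HasFDerivAt (fun w => (F w).1 i) _ z := h
  rw [h2.fderiv]
  rfl

lemma fderiv_snd_apply {F : E m n → E m n} {z : E m n} (hF : DifferentiableAt ℝ F z) (v : E m n)
    (j : Fin n) : (fderiv ℝ F z v).2 j = fderiv ℝ (fun w => (F w).2 j) z v := by
  have h := (((EuclideanSpace.proj j : EuclideanSpace ℝ (Fin n) →L[ℝ] ℝ).comp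
    (ContinuousLinearMap.snd ℝ (EuclideanSpace ℝ (Fin m))
      (EuclideanSpace ℝ (Fin n)))).hasFDerivAt (x := F z)).comp z hF.hasFDerivAt
  have h2 : HasFDerivAt (fun w => (F w).2 j) _ z := h
  rw [h2.fderiv]
  rfl

lemma continuous_divg {G : E m n → E m n} (hG : ContDiff ℝ 1 G) : Continuous (divg G) := by
  have := hG.continuous_fderiv one_ne_zero
  unfold divg
  fun_prop

lemma hasCompactSupport_divg {G : E m n → E m n} (hc : HasCompactSupport G) :
    HasCompactSupport (divg G) := by
  refine (hc.fderiv ℝ).mono' fun z hz => subset_tsupport _ fun h => hz ?_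
  simp [divg, h]

lemma integral_divg_eq_zero {G : E m n → E m n} (hG : ContDiff ℝ 1 G)
    (hc : HasCompactSupport G) : ∫ z, divg G z = 0 := by
  have hcfst : ∀ i, HasCompactSupport fun z => (G z).1 i := fun i =>
    hc.comp_left (g := fun p : E m n => p.1 i) rfl
  have hcsnd : ∀ j, HasCompactSupport fun z => (G z).2 j := fun j =>
    hc.comp_left (g := fun p : E m n => p.2 j) rfl
  have hfst : ∀ i, ContDiff ℝ 1 fun z => (G z).1 i := fun i => by
    have := (EuclideanSpace.proj i : EuclideanSpace ℝ (Fin m) →L[ℝ] ℝ).contDiff (n := 1)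
    exact this.comp hG.fst
  have hsnd : ∀ j, ContDiff ℝ 1 fun z => (G z).2 j := fun j => by
    have := (EuclideanSpace.proj j : EuclideanSpace ℝ (Fin n) →L[ℝ] ℝ).contDiff (n := 1)
    exact this.comp hG.snd
  have hint : ∀ {f : E m n → ℝ}, ContDiff ℝ 1 f → HasCompactSupport f → ∀ v,
      Integrable fun z => fderiv ℝ f z v := by
    intro f hf hfc v
    have hf' : Continuous fun z => fderiv ℝ f z v := by
      have := hf.continuous_fderiv one_ne_zero
      fun_prop
    have := isAddHaarMeasure_volume_prod (m := m) (n := n)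
    exact hf'.integrable_of_hasCompactSupport (hfc.fderiv_apply ℝ v)
  have hd := hG.differentiable one_ne_zero
  simp only [divg, fderiv_fst_apply (hd _), fderiv_snd_apply (hd _)]
  rw [integral_add, integral_finsetSum, integral_finsetSum]
  · rw [Finset.sum_eq_zero, Finset.sum_eq_zero, add_zero]
    · exact fun j _ => integral_fderiv_apply_eq_zero (hsnd j) (hcsnd j) _
    · exact fun i _ => integral_fderiv_apply_eq_zero (hfst i) (hcfst i) _
  · exact fun j _ => hint (hsnd j) (hcsnd j) _
  · exact fun i _ => hint (hfst i) (hcfst i) _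
  · exact integrable_finsetSum _ fun i _ => hint (hfst i) (hcfst i) _
  · exact integrable_finsetSum _ fun j _ => hint (hsnd j) (hcsnd j) _

lemma divg_smul {a : E m n → ℝ} {a' : E m n →L[ℝ] ℝ} {F : E m n → E m n} {z : E m n}
    (ha : HasFDerivAt a a' z) (hF : DifferentiableAt ℝ F z) :
    divg (fun w => a w • F w) z = a z * divg F z + a' (F z) := by
  have h : HasFDerivAt (fun w => a w • F w) _ z := ha.smul hF.hasFDerivAt
  have h2 : a' (F z) = a' ((F z).1, 0) + a' (0, (F z).2) := by
    rw [← map_add]; simp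
  unfold divg
  rw [h.fderiv, h2, apply_fst_eq_sum, apply_snd_eq_sum, mul_add, Finset.mul_sum, Finset.mul_sum]
  have h3 : ∀ v : E m n, (a z • fderiv ℝ F z + a'.smulRight (F z)) v =
    a z • fderiv ℝ F z v + a' v • F z := fun v => rfl
  simp only [h3, Prod.fst_add, Prod.snd_add, Prod.smul_fst, Prod.smul_snd, PiLp.add_apply,
    PiLp.smul_apply, smul_eq_mul, Finset.sum_add_distrib]
  simp only [mul_comm ((F z).1 _), mul_comm ((F z).2 _)]
  ring

end Divergence

section DivergenceTheorem

variable {m n : ℕ}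

/-- One-sided divergence theorem on a sublevel set `{R < c}` with a surface term measured by the
Hausdorff measure, for fields that may be singular on `{x = 0}`. -/
theorem ofReal_integral_divergence_le {R : E m n → ℝ} (hR : ContDiff ℝ 1 R) {b c : ℝ} (hbc : b < c)
    (hKc : IsCompact {z | R z ≤ c}) (hgrad : ∀ z, b ≤ R z → R z ≤ c → fderiv ℝ R z ≠ 0)
    {U V : Set (E m n)} (hU : IsOpen U) (hcU : {z | R z ≤ c} ⊆ U) (hV : IsOpen V)
    (hKV : {z | b ≤ R z ∧ R z ≤ c} ⊆ V)
    {F : E m n → E m n} (hF : ContDiffOn ℝ 1 F (U ∩ {z | z.1 ≠ 0}))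
    {C : ℝ} (hFC : ∀ z, R z < c → z.1 ≠ 0 → ‖z.1‖ * ‖(F z).1‖ ≤ C)
    {d H : E m n → ℝ} (hd : IntegrableOn d {z | R z < c})
    (hdiv : ∀ z, R z < c → z.1 ≠ 0 → divg F z = d z) (hH : ContinuousOn H V)
    (hHF : ∀ z, b ≤ R z → R z < c → z.1 ≠ 0 → H z = fderiv ℝ R z (F z))
    (hinv : IntegrableOn (fun z : E m n => (‖z.1‖ ^ 2)⁻¹) {z | R z < c})
    (hnull : ∀ᵐ z : E m n, z.1 ≠ 0) :
    ENNReal.ofReal (∫ z in {z | R z < c}, d z) ≤ ENNReal.ofReal (7 / 4) *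
      ∫⁻ z in {z | R z = c}, ENNReal.ofReal (H z / gradNorm R z) ∂μH[(m + n - 1 : ℝ)] := by
  have := isAddHaarMeasure_volume_prod (m := m) (n := n)
  obtain ⟨κ, κ', hκ, hκc', hκ1, hκ0, hκnn, hκle, hκ'nn, hκ'le, hκ's⟩ := exists_cutoff_profile
  have hκc : Continuous κ := continuous_iff_continuousAt.2 fun s => (hκ s).continuousAt
  have hκC : ContDiff ℝ 1 κ := by
    rw [contDiff_one_iff_deriv]
    refine ⟨fun s => (hκ s).differentiableAt, ?_⟩
    rwa [show deriv κ = κ' from funext fun s => (hκ s).deriv]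
  have hRc := hR.continuous
  have hBm : MeasurableSet {z | R z < c} := (isOpen_lt hRc continuous_const).measurableSet
  set q : ℝ → E m n → ℝ := fun ε z => ‖z.1‖ ^ 2 / ε ^ 2 - 1 with hq
  set p : ℝ → E m n → ℝ := fun ε z => (R z - c) / ε + 1 with hp
  have hqC : ∀ ε, ContDiff ℝ 1 (q ε) := fun ε =>
    ((contDiff_fst.norm_sq ℝ).div_const _).sub contDiff_const
  have hpC : ∀ ε, ContDiff ℝ 1 (p ε) := fun ε =>
    ((hR.sub contDiff_const).div_const _).add contDiff_const
  set T : ℝ → E m n → ℝ := fun ε z => κ (p ε z) * ((1 - κ (q ε z)) * d z +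
    -(κ' (q ε z)) * ((ε ^ 2)⁻¹ * (2 * inner ℝ z.1 (F z).1))) with hT
  set S : ℝ → E m n → ℝ := fun ε z => (1 - κ (q ε z)) * (κ' (p ε z) / ε) * H z with hS
  have hp1 : ∀ {ε : ℝ}, 0 < ε → ∀ z, c ≤ R z → 1 ≤ p ε z := fun hε z h => by
    have : 0 ≤ (R z - c) / _ := div_nonneg (sub_nonneg.2 h) hε.le
    simp only [p]; linarith
  have hp0 : ∀ {ε : ℝ}, 0 < ε → ∀ z, R z ≤ c - ε → p ε z ≤ 0 := fun {ε} hε z h => by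
    have : (R z - c) / ε ≤ -1 := by rw [div_le_iff₀ hε]; linarith
    simp only [p]; linarith
  have hq0 : ∀ {ε : ℝ}, 0 < ε → ∀ z : E m n, ‖z.1‖ ^ 2 ≤ ε ^ 2 → q ε z ≤ 0 := fun {ε} hε z h => by
    have : ‖z.1‖ ^ 2 / ε ^ 2 ≤ 1 := by rw [div_le_one (by positivity)]; exact h
    simp only [q]; linarith
  have hq1 : ∀ {ε : ℝ}, 0 < ε → ∀ z : E m n, 2 * ε ^ 2 ≤ ‖z.1‖ ^ 2 → 1 ≤ q ε z := fun {ε} hε z h => by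
    have : 2 ≤ ‖z.1‖ ^ 2 / ε ^ 2 := by rw [le_div_iff₀ (by positivity)]; exact h
    simp only [q]; linarith
  have hκ'0 : ∀ s ≤ 0, κ' s = 0 := fun s hs => hκ's s fun h => absurd h.1 (not_lt.2 hs)
  have hκ'1 : ∀ s, 1 ≤ s → κ' s = 0 := fun s hs => hκ's s fun h => absurd h.2 (not_lt.2 hs)
  -- for fixed `ε`, `T ε + S ε` is the divergence of a compactly supported field
  have hfield : ∀ ε, 0 < ε → ε < c - b → ∃ D : E m n → ℝ, Integrable D ∧ Integrable (S ε) ∧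
      ∫ z, D z = 0 ∧ ∀ z, D z = T ε z + S ε z := by
    intro ε hε hεb
    set a : E m n → ℝ := fun z => (1 - κ (q ε z)) * κ (p ε z) with ha
    have haC : ContDiff ℝ 1 a :=
      (contDiff_const.sub (hκC.comp (hqC ε))).mul (hκC.comp (hpC ε))
    have hats : tsupport a ⊆ {z | R z ≤ c} ∩ {z | ε ^ 2 ≤ ‖z.1‖ ^ 2} := by
      refine closure_minimal (fun z hz => ⟨?_, ?_⟩) ((isClosed_le hRc continuous_const).inter
        (isClosed_le continuous_const (by fun_prop)))
      · by_contra h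
        exact hz (by simp [a, hκ0 _ (hp1 hε z (not_le.1 h).le)])
      · by_contra h
        exact hz (by simp [a, hκ1 _ (hq0 hε z (not_le.1 h).le)])
    have hats' : tsupport a ⊆ U ∩ {z | z.1 ≠ 0} := fun z hz => by
      obtain ⟨h1, h2⟩ := hats hz
      refine ⟨hcU h1, fun h0 => ?_⟩
      have h3 : ε ^ 2 ≤ ‖z.1‖ ^ 2 := h2
      rw [h0, norm_zero] at h3
      have : 0 < ε ^ 2 := by positivity
      norm_num at h3
      linarith
    have hopen : IsOpen (U ∩ {z : E m n | z.1 ≠ 0}) :=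
      hU.inter (isOpen_ne_fun continuous_fst continuous_const)
    have hac : HasCompactSupport a :=
      hKc.of_isClosed_subset (isClosed_tsupport _) fun z hz => (hats hz).1
    have hGC : ContDiff ℝ 1 fun w => a w • F w := by
      rw [contDiff_iff_contDiffAt]
      intro z
      by_cases hz : z ∈ tsupport a
      · exact haC.contDiffAt.smul (hF.contDiffAt (hopen.mem_nhds (hats' hz)))
      · refine (contDiffAt_const (c := (0 : E m n))).congr_of_eventuallyEq ?_
        filter_upwards [notMem_tsupport_iff_eventuallyEq.1 hz] with w hw
        simp [hw]
    have hGc : HasCompactSupport fun w => a w • F w := hac.smul_right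
    have hderiv : ∀ z, HasFDerivAt a ((1 - κ (q ε z)) • ((κ' (p ε z)) • (ε⁻¹ • fderiv ℝ R z)) +
        κ (p ε z) • (-((κ' (q ε z)) • ((ε ^ 2)⁻¹ • ((2 : ℕ) • (innerSL ℝ z.1).comp
          (ContinuousLinearMap.fst ℝ (EuclideanSpace ℝ (Fin m)) (EuclideanSpace ℝ (Fin n)))))))) z := by
      intro z
      have h1 : HasFDerivAt (p ε) (ε⁻¹ • fderiv ℝ R z) z := by
        have := ((((hR.differentiable one_ne_zero) z).hasFDerivAt.sub_const c).const_mul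
          ε⁻¹).add_const 1
        refine this.congr_of_eventuallyEq (Filter.Eventually.of_forall fun w => ?_)
        simp only [p]; ring
      have h2 : HasFDerivAt (q ε) ((ε ^ 2)⁻¹ • ((2 : ℕ) • (innerSL ℝ z.1).comp
          (ContinuousLinearMap.fst ℝ (EuclideanSpace ℝ (Fin m)) (EuclideanSpace ℝ (Fin n))))) z := by
        have := ((((ContinuousLinearMap.fst ℝ (EuclideanSpace ℝ (Fin m))
          (EuclideanSpace ℝ (Fin n))).hasFDerivAt (x := z)).norm_sq).const_mul
          (ε ^ 2)⁻¹).sub_const 1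
        refine this.congr_of_eventuallyEq (Filter.Eventually.of_forall fun w => ?_)
        simp only [q, ContinuousLinearMap.coe_fst']; ring
      exact (((hκ _).comp_hasFDerivAt z h2).const_sub 1).mul ((hκ _).comp_hasFDerivAt z h1)
    refine ⟨divg fun w => a w • F w, (continuous_divg hGC).integrable_of_hasCompactSupport
      (hasCompactSupport_divg hGc), ?_, integral_divg_eq_zero hGC hGc, fun z => ?_⟩
    · have hbts : tsupport (fun z => (1 - κ (q ε z)) * (κ' (p ε z) / ε)) ⊆
          {z | b ≤ R z ∧ R z ≤ c} := by
        refine closure_minimal (fun z hz => ?_)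
          ((isClosed_le continuous_const hRc).inter (isClosed_le hRc continuous_const))
        have hκz : κ' (p ε z) ≠ 0 := fun h0 => hz (by simp [h0])
        constructor
        · by_contra h
          exact hκz (hκ'0 _ (hp0 hε z (by linarith [not_le.1 h])))
        · by_contra h
          exact hκz (hκ'1 _ (hp1 hε z (not_le.1 h).le))
      have hSc : Continuous (S ε) := by
        refine continuous_of_tsupport fun z hz => ?_
        have hz' := hKV (hbts (tsupport_mul_subset_left hz))
        have h1 := (hqC ε).continuous
        have h2 := (hpC ε).continuous
        have h3 : Continuous fun z => (1 - κ (q ε z)) * (κ' (p ε z) / ε) := by fun_prop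
        exact h3.continuousAt.mul (hH.continuousAt (hV.mem_nhds hz'))
      refine hSc.integrable_of_hasCompactSupport
        (hKc.of_isClosed_subset (isClosed_tsupport _) fun z hz => ?_)
      exact (hbts (tsupport_mul_subset_left hz)).2
    · by_cases hz : z.1 ≠ 0 ∧ R z ≤ c
      · have hFz : DifferentiableAt ℝ F z :=
          (hF.contDiffAt (hopen.mem_nhds ⟨hcU hz.2, hz.1⟩)).differentiableAt one_ne_zero
        rw [divg_smul (hderiv z) hFz]
        have happ : ((1 - κ (q ε z)) • ((κ' (p ε z)) • (ε⁻¹ • fderiv ℝ R z)) +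
          κ (p ε z) • (-((κ' (q ε z)) • ((ε ^ 2)⁻¹ • ((2 : ℕ) • (innerSL ℝ z.1).comp
          (ContinuousLinearMap.fst ℝ (EuclideanSpace ℝ (Fin m)) (EuclideanSpace ℝ (Fin n)))))))) (F z) =
          (1 - κ (q ε z)) * (κ' (p ε z) * (ε⁻¹ * fderiv ℝ R z (F z))) +
          κ (p ε z) * (-(κ' (q ε z) * ((ε ^ 2)⁻¹ * (2 * inner ℝ z.1 (F z).1)))) := by
          simp
        rw [happ]
        rcases hz.2.lt_or_eq with hlt | heq
        · rw [hdiv z hlt hz.1]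
          simp only [T, S, a]
          rcases le_or_gt b (R z) with hb | hb
          · rw [hHF z hb hlt hz.1]
            ring
          · rw [hκ'0 _ (hp0 hε z (by linarith))]
            ring
        · simp only [T, S, a]
          rw [hκ'1 _ (hp1 hε z heq.ge), hκ0 _ (hp1 hε z heq.ge)]
          ring
      · have hzt : z ∉ tsupport a := fun h => hz ⟨(hats' h).2, (hats h).1⟩
        have h0 : divg (fun w => a w • F w) z = 0 := by
          have : (fun w => a w • F w) =ᶠ[nhds z] fun _ => (0 : E m n) := by
            filter_upwards [notMem_tsupport_iff_eventuallyEq.1 hzt] with w hw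
            simp [hw]
          simp [divg, this.fderiv_eq]
        rw [h0]
        simp only [T, S]
        by_cases hz1 : z.1 = 0
        · have : q ε z ≤ 0 := hq0 hε z (by rw [hz1]; simp; positivity)
          rw [hκ1 _ this, hκ'0 _ this]
          ring
        · have : c ≤ R z := by
            by_contra h
            exact hz ⟨hz1, (not_le.1 h).le⟩
          rw [hκ'1 _ (hp1 hε z this), hκ0 _ (hp1 hε z this)]
          ring
  have hsmall : ∀ᶠ ε : ℝ in nhdsWithin 0 (Set.Ioi 0), ε < c - b :=
    nhdsWithin_le_nhds (eventually_lt_nhds (by linarith))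
  have hlim : Filter.Tendsto (fun ε => ∫ z, T ε z) (nhdsWithin 0 (Set.Ioi 0))
      (nhds (∫ z, {z | R z < c}.indicator d z)) := by
    refine tendsto_integral_filter_of_dominated_convergence
      ({z | R z < c}.indicator fun z => |d z| + 14 / 3 * C * (‖z.1‖ ^ 2)⁻¹) ?_ ?_ ?_ ?_
    · filter_upwards [hsmall, self_mem_nhdsWithin] with ε hε hε0
      obtain ⟨D, hD, hSi, -, h⟩ := hfield ε hε0 hε
      have : T ε = fun z => D z - S ε z := funext fun z => by rw [h]; ring
      rw [this]
      exact (hD.sub hSi).aestronglyMeasurable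
    · filter_upwards [self_mem_nhdsWithin] with ε hε0
      replace hε0 : 0 < ε := hε0
      filter_upwards [hnull] with z hz
      rcases lt_or_ge (R z) c with h | h
      · rw [Set.indicator_of_mem (show z ∈ {z | R z < c} from h), Real.norm_eq_abs]
        have hx : 0 < ‖z.1‖ := norm_pos_iff.2 hz
        have hC := hFC z h hz
        have hC0 : 0 ≤ C := le_trans (by positivity) hC
        have h1 : |(1 - κ (q ε z)) * d z| ≤ |d z| := by
          rw [abs_mul, abs_of_nonneg (sub_nonneg.2 (hκle _))]
          exact mul_le_of_le_one_left (abs_nonneg _) (by linarith [hκnn (q ε z)])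
        have h2 : |-(κ' (q ε z)) * ((ε ^ 2)⁻¹ * (2 * inner ℝ z.1 (F z).1))| ≤
            14 / 3 * C * (‖z.1‖ ^ 2)⁻¹ := by
          by_cases hqz : 2 * ε ^ 2 ≤ ‖z.1‖ ^ 2
          · rw [hκ'1 _ (hq1 hε0 z hqz), neg_zero, zero_mul, abs_zero]
            positivity
          · have h3 : (ε ^ 2)⁻¹ ≤ 2 * (‖z.1‖ ^ 2)⁻¹ := by
              rw [← div_eq_mul_inv, inv_le_comm₀ (by positivity) (by positivity), inv_div]
              linarith
            have h4 : |inner ℝ z.1 (F z).1| ≤ C := (abs_real_inner_le_norm _ _).trans hC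
            rw [abs_mul, abs_of_nonneg (hκ'nn _), abs_mul, abs_of_nonneg (by positivity), abs_mul,
              abs_two]
            calc -κ' (q ε z) * ((ε ^ 2)⁻¹ * (2 * |inner ℝ z.1 (F z).1|))
                ≤ 7 / 6 * ((2 * (‖z.1‖ ^ 2)⁻¹) * (2 * C)) := by
                  have := hκ'le (q ε z)
                  gcongr
              _ = _ := by ring
        rw [hT]
        simp only
        rw [abs_mul, abs_of_nonneg (hκnn _)]
        refine (mul_le_of_le_one_left (abs_nonneg _) (hκle _)).trans ?_
        exact (abs_add_le _ _).trans (add_le_add h1 h2)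
      · rw [Set.indicator_of_notMem (by simpa using h)]
        simp [T, hκ0 _ (hp1 hε0 z h)]
    · rw [integrable_indicator_iff hBm]
      exact hd.abs.add (hinv.const_mul _)
    · filter_upwards [hnull] with z hz
      refine tendsto_const_nhds.congr' ?_
      have hx : 0 < ‖z.1‖ := norm_pos_iff.2 hz
      have ev1 : ∀ᶠ ε : ℝ in nhdsWithin 0 (Set.Ioi 0), 2 * ε ^ 2 < ‖z.1‖ ^ 2 := by
        refine nhdsWithin_le_nhds ?_
        refine (by fun_prop : Continuous fun ε : ℝ => 2 * ε ^ 2).continuousAt.eventually_lt_const ?_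
        simp only [ne_eq, OfNat.ofNat_ne_zero, not_false_eq_true, zero_pow, mul_zero]
        positivity
      rcases lt_or_ge (R z) c with h | h
      · have ev2 : ∀ᶠ ε : ℝ in nhdsWithin 0 (Set.Ioi 0), ε < c - R z :=
          nhdsWithin_le_nhds (eventually_lt_nhds (by linarith))
        filter_upwards [ev1, ev2, self_mem_nhdsWithin] with ε h1 h2 hε0
        replace hε0 : 0 < ε := hε0
        rw [Set.indicator_of_mem (show z ∈ {z | R z < c} from h)]
        simp only [T]
        rw [hκ1 _ (hp0 hε0 z (by linarith)), hκ0 _ (hq1 hε0 z h1.le), hκ'1 _ (hq1 hε0 z h1.le)]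
        ring
      · filter_upwards [self_mem_nhdsWithin] with ε hε0
        rw [Set.indicator_of_notMem (by simpa using h)]
        simp [T, hκ0 _ (hp1 hε0 z h)]
  rw [integral_indicator hBm] at hlim
  set I := ∫⁻ z in {z | R z = c}, ENNReal.ofReal (3 / 2 * H z / gradNorm R z)
    ∂μH[(m + n - 1 : ℝ)] with hI
  have hKcomp : IsCompact {z | b ≤ R z ∧ R z ≤ c} :=
    hKc.of_isClosed_subset ((isClosed_le continuous_const hRc).inter
      (isClosed_le hRc continuous_const)) fun z hz => hz.2
  have hbound : ∀ η : ENNReal, η ≠ 0 →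
      ENNReal.ofReal (∫ z in {z | R z < c}, d z) ≤ ENNReal.ofReal (7 / 6) * (I + η) := by
    intro η hη
    refine le_of_tendsto ((ENNReal.continuous_ofReal.tendsto _).comp hlim) ?_
    filter_upwards [hsmall, self_mem_nhdsWithin,
      lintegral_shell_le hR hbc hKcomp hgrad hV hKV hH hη] with ε hε hε0 hshell
    replace hε0 : 0 < ε := hε0
    obtain ⟨D, hD, hSi, hD0, h⟩ := hfield ε hε0 hε
    have hTS : ∫ z, T ε z = ∫ z, - S ε z := by
      have : T ε = fun z => D z - S ε z := funext fun z => by rw [h]; ring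
      rw [this, integral_sub hD hSi, hD0, integral_neg, zero_sub]
    have hAm : MeasurableSet {z | c - ε < R z ∧ R z < c} :=
      ((isOpen_lt continuous_const hRc).inter (isOpen_lt hRc continuous_const)).measurableSet
    simp only [Function.comp_apply]
    rw [hTS]
    calc ENNReal.ofReal (∫ z, - S ε z) ≤ ∫⁻ z, ENNReal.ofReal (- S ε z) :=
          ofReal_integral_le_lintegral_ofReal _
      _ ≤ ∫⁻ z, {z | c - ε < R z ∧ R z < c}.indicator
          (fun z => ENNReal.ofReal (7 / 6 / ε) * ENNReal.ofReal (H z)) z := by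
          refine lintegral_mono fun z => ?_
          by_cases hz : c - ε < R z ∧ R z < c
          · rw [Set.indicator_of_mem (show z ∈ {z | c - ε < R z ∧ R z < c} from hz),
              ← ENNReal.ofReal_mul (by positivity)]
            rcases le_or_gt (H z) 0 with hHz | hHz
            · rw [ENNReal.ofReal_of_nonpos]
              · exact zero_le
              · have h1 : 0 ≤ (1 - κ (q ε z)) * (-κ' (p ε z) / ε) :=
                  mul_nonneg (sub_nonneg.2 (hκle _)) (div_nonneg (hκ'nn _) hε0.le)
                have h2 : - S ε z = ((1 - κ (q ε z)) * (-κ' (p ε z) / ε)) * H z := by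
                  simp only [S]; ring
                rw [h2]
                exact mul_nonpos_of_nonneg_of_nonpos h1 hHz
            · refine ENNReal.ofReal_le_ofReal ?_
              have h2 : - S ε z = ((1 - κ (q ε z)) * (-κ' (p ε z) / ε)) * H z := by
                simp only [S]; ring
              rw [h2]
              refine mul_le_mul_of_nonneg_right ?_ hHz.le
              have h3 : -κ' (p ε z) / ε ≤ 7 / 6 / ε := by
                have := hκ'le (p ε z)
                gcongr
              refine (mul_le_of_le_one_left (div_nonneg (hκ'nn _) hε0.le) ?_).trans h3
              linarith [hκnn (q ε z)]
          · have : κ' (p ε z) = 0 := by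
              rcases le_or_gt (R z) (c - ε) with h1 | h1
              · exact hκ'0 _ (hp0 hε0 z h1)
              · exact hκ'1 _ (hp1 hε0 z (not_lt.1 fun h2 => hz ⟨h1, h2⟩))
            simp [S, this]
      _ = ENNReal.ofReal (7 / 6 / ε) *
          ∫⁻ z in {z | c - ε < R z ∧ R z < c}, ENNReal.ofReal (H z) := by
          rw [lintegral_indicator hAm, lintegral_const_mul' _ _ ENNReal.ofReal_ne_top]
      _ ≤ ENNReal.ofReal (7 / 6 / ε) * (ENNReal.ofReal ε * (I + η)) := by gcongr
      _ = _ := by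
          rw [← mul_assoc, ← ENNReal.ofReal_mul (by positivity), div_mul_cancel₀ _ hε0.ne']
  have hfinal : ENNReal.ofReal (∫ z in {z | R z < c}, d z) ≤ ENNReal.ofReal (7 / 6) * I := by
    refine ENNReal.le_of_forall_pos_le_add fun η hη _ => ?_
    refine (hbound (η / 2) ?_).trans ?_
    · exact ENNReal.div_ne_zero.2 ⟨by exact_mod_cast hη.ne', ENNReal.ofNat_ne_top⟩
    · rw [mul_add]
      gcongr
      calc ENNReal.ofReal (7 / 6) * ((η : ENNReal) / 2) ≤ 2 * ((η : ENNReal) / 2) := by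
            gcongr
            exact ENNReal.ofReal_le_of_le_toReal (by norm_num)
        _ = η := ENNReal.mul_div_cancel two_ne_zero ENNReal.ofNat_ne_top
  refine hfinal.trans_eq ?_
  have : ∀ z, ENNReal.ofReal (3 / 2 * H z / gradNorm R z) =
      ENNReal.ofReal (3 / 2) * ENNReal.ofReal (H z / gradNorm R z) := fun z => by
    rw [← ENNReal.ofReal_mul (by norm_num), mul_div_assoc]
  rw [hI]
  simp only [this]
  rw [lintegral_const_mul' _ _ ENNReal.ofReal_ne_top, ← mul_assoc,
    ← ENNReal.ofReal_mul (by norm_num)]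
  norm_num

end DivergenceTheorem

section Gauge

variable {m n : ℕ}

/-- The power `ρ^{2(α+1)}` of the gauge. -/
def gaugePow (α : ℝ) (z : E m n) : ℝ :=
  ‖z.1‖ ^ (2 * (α + 1)) + (α + 1) ^ 2 * ‖z.2‖ ^ 2

lemma gaugePow_nonneg (α : ℝ) (z : E m n) : 0 ≤ gaugePow α z := by
  unfold gaugePow; positivity

lemma rho_eq (α : ℝ) (z : E m n) : rho α z = gaugePow α z ^ (2 * (α + 1))⁻¹ := by
  unfold rho gaugePow
  rw [one_div]

lemma rho_lt_iff {α r : ℝ} (hα : 0 < α) (hr : 0 < r) (z : E m n) :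
    rho α z < r ↔ gaugePow α z < r ^ (2 * (α + 1)) := by
  rw [rho_eq, Real.rpow_inv_lt_iff_of_pos (gaugePow_nonneg α z) hr.le (by linarith)]

lemma rho_le_iff {α r : ℝ} (hα : 0 < α) (hr : 0 < r) (z : E m n) :
    rho α z ≤ r ↔ gaugePow α z ≤ r ^ (2 * (α + 1)) := by
  rw [rho_eq, Real.rpow_inv_le_iff_of_pos (gaugePow_nonneg α z) hr.le (by linarith)]

lemma gball_eq {α r : ℝ} (hα : 0 < α) (hr : 0 < r) :
    (gball α r : Set (E m n)) = {z | gaugePow α z < r ^ (2 * (α + 1))} :=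
  Set.ext fun z => rho_lt_iff hα hr z

lemma gsphere_eq {α r : ℝ} (hα : 0 < α) (hr : 0 < r) :
    (gsphere α r : Set (E m n)) = {z | gaugePow α z = r ^ (2 * (α + 1))} := by
  ext z
  have h1 := rho_lt_iff hα hr z
  have h2 := rho_le_iff hα hr z
  show rho α z = r ↔ gaugePow α z = r ^ (2 * (α + 1))
  constructor
  · intro h
    exact le_antisymm (h2.1 h.le) (not_lt.1 fun h3 => absurd (h1.2 h3) (by rw [h]; exact lt_irrefl _))
  · intro h
    exact le_antisymm (h2.2 h.le) (not_lt.1 fun h3 => absurd (h1.1 h3) (by rw [h]; exact lt_irrefl _))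

lemma norm_fst_le_of_gaugePow_le {α r : ℝ} (hα : 0 < α) (hr : 0 < r) {z : E m n}
    (hz : gaugePow α z ≤ r ^ (2 * (α + 1))) : ‖z.1‖ ≤ r := by
  rw [← Real.rpow_le_rpow_iff (norm_nonneg _) hr.le (show 0 < 2 * (α + 1) by linarith)]
  refine le_trans ?_ hz
  unfold gaugePow
  have : 0 ≤ (α + 1) ^ 2 * ‖z.2‖ ^ 2 := by positivity
  linarith

lemma norm_snd_le_of_gaugePow_le {α : ℝ} (hα : 0 < α) {c : ℝ} {z : E m n}
    (hz : gaugePow α z ≤ c) : ‖z.2‖ ≤ c + 1 := by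
  have h1 : 0 ≤ ‖z.1‖ ^ (2 * (α + 1)) := by positivity
  unfold gaugePow at hz
  have h2 : ‖z.2‖ ^ 2 ≤ (α + 1) ^ 2 * ‖z.2‖ ^ 2 := by
    refine le_mul_of_one_le_left (by positivity) ?_
    nlinarith
  nlinarith [sq_nonneg (‖z.2‖ - 1)]

lemma contDiff_gaugePow {α : ℝ} (hα : 0 < α) : ContDiff ℝ 1 (gaugePow α : E m n → ℝ) := by
  unfold gaugePow
  exact ((contDiff_norm_rpow (by linarith)).comp contDiff_fst).add
    (contDiff_const.mul (contDiff_snd.norm_sq ℝ))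

lemma fderiv_gaugePow_apply {α : ℝ} (hα : 0 < α) (z v : E m n) :
    fderiv ℝ (gaugePow α) z v = 2 * (α + 1) * ‖z.1‖ ^ (2 * α) * inner ℝ z.1 v.1 +
      2 * (α + 1) ^ 2 * inner ℝ z.2 v.2 := by
  have h1 := (hasFDerivAt_norm_rpow z.1 (show 1 < 2 * (α + 1) by linarith)).comp z
    ((ContinuousLinearMap.fst ℝ (EuclideanSpace ℝ (Fin m))
      (EuclideanSpace ℝ (Fin n))).hasFDerivAt (x := z))
  have h2 := (((ContinuousLinearMap.snd ℝ (EuclideanSpace ℝ (Fin m))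
    (EuclideanSpace ℝ (Fin n))).hasFDerivAt (x := z)).norm_sq).const_mul ((α + 1) ^ 2)
  have h : HasFDerivAt (gaugePow α) _ z := h1.add h2
  rw [h.fderiv]
  simp
  ring_nf

lemma isCompact_gaugePow_le {α r : ℝ} (hα : 0 < α) (hr : 0 < r) :
    IsCompact {z : E m n | gaugePow α z ≤ r ^ (2 * (α + 1))} := by
  refine Metric.isCompact_of_isClosed_isBounded
    (isClosed_le (contDiff_gaugePow hα).continuous continuous_const) ?_
  refine (Metric.isBounded_closedBall (x := (0 : E m n))
    (r := max r (r ^ (2 * (α + 1)) + 1))).subset fun z hz => ?_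
  rw [mem_closedBall_zero_iff, Prod.norm_def]
  exact max_le_max (norm_fst_le_of_gaugePow_le hα hr hz) (norm_snd_le_of_gaugePow_le hα hz)

lemma fderiv_gaugePow_ne_zero {α : ℝ} (hα : 0 < α) {z : E m n} (hz : 0 < gaugePow α z) :
    fderiv ℝ (gaugePow α) z ≠ 0 := by
  intro h0
  have h := fderiv_gaugePow_apply hα z z
  rw [h0, _root_.zero_apply, real_inner_self_eq_norm_sq, real_inner_self_eq_norm_sq] at h
  have h1 : 0 ≤ 2 * (α + 1) * ‖z.1‖ ^ (2 * α) * ‖z.1‖ ^ 2 := by positivity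
  have h2 : 0 ≤ 2 * (α + 1) ^ 2 * ‖z.2‖ ^ 2 := by positivity
  have h3 : z.1 = 0 := by
    by_contra h
    have := norm_pos_iff.2 h
    have : 0 < 2 * (α + 1) * ‖z.1‖ ^ (2 * α) * ‖z.1‖ ^ 2 := by positivity
    linarith
  have h4 : z.2 = 0 := by
    by_contra h
    have := norm_pos_iff.2 h
    have : 0 < 2 * (α + 1) ^ 2 * ‖z.2‖ ^ 2 := by positivity
    linarith
  unfold gaugePow at hz
  rw [h3, h4, norm_zero, norm_zero, Real.zero_rpow (by linarith)] at hz
  norm_num at hz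

lemma rpow_two_mul_add_one {α x : ℝ} (hx : 0 ≤ x) (hα : 0 < α) :
    x ^ (2 * (α + 1)) = x ^ (2 * α) * x ^ 2 := by
  rw [show 2 * (α + 1) = 2 * α + (2 : ℕ) by push_cast; ring,
    Real.rpow_add_natCast' hx (by push_cast; linarith)]

lemma normGradRho_eq {α r : ℝ} (hα : 0 < α) (hr : 0 < r) {z : E m n}
    (hz : gaugePow α z = r ^ (2 * (α + 1))) :
    normGradRho α z = r * (r ^ (2 * (α + 1)))⁻¹ * (2 * (α + 1))⁻¹ * gradNorm (gaugePow α) z := by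
  have hc : 0 < r ^ (2 * (α + 1)) := by positivity
  have hd : HasFDerivAt (gaugePow α) (fderiv ℝ (gaugePow α) z) z :=
    ((contDiff_gaugePow hα).differentiable one_ne_zero z).hasFDerivAt
  have h : HasFDerivAt (rho α)
      ((r * (r ^ (2 * (α + 1)))⁻¹ * (2 * (α + 1))⁻¹) • fderiv ℝ (gaugePow α) z) z := by
    have h1 := hd.rpow_const (p := (2 * (α + 1))⁻¹) (Or.inl (by rw [hz]; exact hc.ne'))
    have h2 : (rho α : E m n → ℝ) = fun w => gaugePow α w ^ (2 * (α + 1))⁻¹ :=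
      funext fun w => rho_eq α w
    rw [h2]
    refine h1.congr_fderiv ?_
    rw [hz, Real.rpow_sub_one hc.ne', ← Real.rpow_mul hr.le, mul_inv_cancel₀ (by linarith),
      Real.rpow_one]
    congr 1
    ring
  set k := r * (r ^ (2 * (α + 1)))⁻¹ * (2 * (α + 1))⁻¹ with hkdef
  have hk : 0 ≤ k := by positivity
  unfold normGradRho gradNorm
  rw [h.fderiv]
  simp only [_root_.smul_apply, smul_eq_mul, mul_pow, ← Finset.mul_sum]
  rw [← mul_add, Real.sqrt_mul (by positivity), Real.sqrt_sq hk]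

lemma psi_div_normGradRho {α r : ℝ} (hα : 0 < α) (hr : 0 < r) {z : E m n}
    (hz : gaugePow α z = r ^ (2 * (α + 1))) :
    2 * (α + 1) * ‖z.1‖ ^ (2 * α) / gradNorm (gaugePow α) z =
      r⁻¹ * (psi α z / normGradRho α z) := by
  have hρ : rho α z = r := by
    have : z ∈ gsphere (m := m) (n := n) α r := by rw [gsphere_eq hα hr]; exact hz
    exact this
  have hg : 0 < gradNorm (gaugePow α) z := gradNorm_pos
    (fderiv_gaugePow_ne_zero hα (by rw [hz]; positivity))
  rw [normGradRho_eq hα hr hz, psi, hρ, rpow_two_mul_add_one hr.le hα]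
  have : 0 < r ^ (2 * α) := by positivity
  have : α + 1 ≠ 0 := by linarith
  field_simp

lemma psi_div_rho_pow_six {α : ℝ} (hα : 0 < α) {z : E m n} (hz : 0 < gaugePow α z) :
    psi α z / rho α z ^ 6 = ‖z.1‖ ^ (2 * α) * gaugePow α z ^ (-(2 / (α + 1) + 1)) := by
  have hρ : 0 < rho α z := by rw [rho_eq]; positivity
  rw [psi, div_div, ← Real.rpow_add_natCast hρ.ne', rho_eq, ← Real.rpow_mul hz.le,
    Real.rpow_neg hz.le, div_eq_mul_inv]
  congr 3
  have : α + 1 ≠ 0 := by linarith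
  push_cast
  field_simp
  ring

lemma ae_fst_ne_zero (hm : 2 < m) : ∀ᵐ z : E m n, z.1 ≠ 0 := by
  have : NeZero m := ⟨by omega⟩
  rw [Measure.volume_eq_prod]
  exact Measure.quasiMeasurePreserving_fst.ae (Measure.ae_ne _ 0)

lemma integrableOn_inv_norm_fst_sq (hm : 2 < m) {α r : ℝ} (hα : 0 < α) (hr : 0 < r) :
    IntegrableOn (fun z : E m n => (‖z.1‖ ^ 2)⁻¹) {z | gaugePow α z < r ^ (2 * (α + 1))} := by
  have : NeZero m := ⟨by omega⟩
  have h1 : IntegrableOn (fun x : EuclideanSpace ℝ (Fin m) => (‖x‖ ^ 2)⁻¹)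
      (Metric.ball 0 (r + 1)) := by
    rw [integrableOn_fun_norm_addHaar volume (f := fun t => (t ^ 2)⁻¹)]
    have h : IntegrableOn (fun t : ℝ => t ^ (m - 3)) (Set.Ioo 0 (r + 1)) :=
      ((by fun_prop : Continuous fun t : ℝ => t ^ (m - 3)).integrableOn_Icc).mono_set
        Set.Ioo_subset_Icc_self
    refine h.congr_fun (fun t ht => ?_) measurableSet_Ioo
    have ht0 : t ≠ 0 := ht.1.ne'
    rw [finrank_euclideanSpace_fin, smul_eq_mul, show m - 1 = (m - 3) + 2 by omega, pow_add]
    field_simp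
  have h2 : IntegrableOn (fun _ : EuclideanSpace ℝ (Fin n) => (1 : ℝ))
      (Metric.closedBall 0 (r ^ (2 * (α + 1)) + 1)) := by
    rw [integrableOn_const_iff]
    exact Or.inr measure_closedBall_lt_top
  have h3 := Integrable.mul_prod h1 h2
  rw [Measure.prod_restrict, ← Measure.volume_eq_prod] at h3
  simp only [mul_one] at h3
  refine IntegrableOn.mono_set h3 fun z hz => ⟨?_, ?_⟩
  · rw [mem_ball_zero_iff]
    exact (norm_fst_le_of_gaugePow_le hα hr (le_of_lt hz)).trans_lt (lt_add_one r)
  · rw [mem_closedBall_zero_iff]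
    exact norm_snd_le_of_gaugePow_le hα (le_of_lt hz)

end Gauge

section Hardy

variable {m n : ℕ}

lemma setLIntegral_gsphere {α r : ℝ} (hα : 0 < α) (hr : 0 < r) {f : E m n → ℝ}
    (hf : ContinuousOn f {z | gaugePow α z = r ^ (2 * (α + 1))}) (hf0 : ∀ z, 0 ≤ f z) :
    ∫⁻ z in {z : E m n | gaugePow α z = r ^ (2 * (α + 1))},
        ENNReal.ofReal ((2 * (α + 1) * ‖z.1‖ ^ (2 * α) * f z) / gradNorm (gaugePow α) z)
          ∂μH[(m + n - 1 : ℝ)] =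
      ENNReal.ofReal (r⁻¹ * ∫ z in (gsphere α r : Set (E m n)),
        f z * psi α z / normGradRho α z ∂μH[(m + n - 1 : ℝ)]) := by
  have hR := contDiff_gaugePow (m := m) (n := n) hα
  have hc : (0 : ℝ) < r ^ (2 * (α + 1)) := by positivity
  set S := {z : E m n | gaugePow α z = r ^ (2 * (α + 1))} with hS
  have hSc : IsCompact S := (isCompact_gaugePow_le hα hr).of_isClosed_subset
    (isClosed_eq hR.continuous continuous_const) fun z hz => le_of_eq hz
  have hSm : MeasurableSet S := hSc.measurableSet
  have hgrad : ∀ z ∈ S, fderiv ℝ (gaugePow α) z ≠ 0 := fun z hz =>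
    fderiv_gaugePow_ne_zero hα (hc.trans_eq hz.symm)
  have hfin : μH[(m + n - 1 : ℝ)] S < ⊤ := hausdorffMeasure_levelSet_lt_top hR hSc hgrad
  have hcont : ContinuousOn (fun z : E m n =>
      (2 * (α + 1) * ‖z.1‖ ^ (2 * α) * f z) / gradNorm (gaugePow α) z) S := by
    refine ContinuousOn.div (ContinuousOn.mul ?_ hf) (continuous_gradNorm hR).continuousOn
      fun z hz => (gradNorm_pos (hgrad z hz)).ne'
    exact (continuous_const.mul (continuous_fst.norm.rpow_const
      fun _ => Or.inr (by positivity))).continuousOn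
  obtain ⟨C, hC⟩ := hSc.exists_bound_of_continuousOn hcont
  have hint : IntegrableOn (fun z : E m n =>
      (2 * (α + 1) * ‖z.1‖ ^ (2 * α) * f z) / gradNorm (gaugePow α) z) S μH[(m + n - 1 : ℝ)] :=
    have : IsFiniteMeasure (μH[(m + n - 1 : ℝ)].restrict S) := ⟨by simpa using hfin⟩
    Integrable.of_bound (hcont.aestronglyMeasurable hSm) C
      ((ae_restrict_iff' hSm).2 (Filter.Eventually.of_forall hC))
  rw [← ofReal_integral_eq_lintegral_ofReal hint, gsphere_eq hα hr, ← integral_const_mul]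
  · congr 1
    refine setIntegral_congr_fun hSm fun z hz => ?_
    have := psi_div_normGradRho hα hr hz
    calc _ = f z * (2 * (α + 1) * ‖z.1‖ ^ (2 * α) / gradNorm (gaugePow α) z) := by ring
      _ = _ := by rw [this]; ring
  · refine Filter.Eventually.of_forall fun z => ?_
    have := hf0 z
    have : 0 ≤ gradNorm (gaugePow α) z := Real.sqrt_nonneg _
    positivity

lemma integral_gsphere_nonneg {α r : ℝ} {f : E m n → ℝ} (hf0 : ∀ z, 0 ≤ f z) :
    0 ≤ ∫ z in (gsphere α r : Set (E m n)),
        f z * psi α z / normGradRho α z ∂μH[(m + n - 1 : ℝ)] := by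
  refine integral_nonneg fun z => ?_
  have h1 : 0 ≤ rho α z := by unfold rho; positivity
  have h2 : 0 ≤ psi α z := by unfold psi; positivity
  have h3 : 0 ≤ normGradRho α z := Real.sqrt_nonneg _
  exact div_nonneg (mul_nonneg (hf0 z) h2) h3

lemma hasFDerivAt_norm_fst_rpow (α : ℝ) {z : E m n} (hz : z.1 ≠ 0) :
    HasFDerivAt (fun w : E m n => ‖w.1‖ ^ (2 * α))
      ((2 * α * ‖z.1‖ ^ (2 * α - 2)) • (innerSL ℝ z.1).comp
        (ContinuousLinearMap.fst ℝ (EuclideanSpace ℝ (Fin m)) (EuclideanSpace ℝ (Fin n)))) z := by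
  have h0 : 0 < ‖z.1‖ := norm_pos_iff.2 hz
  have h1 := ((hasFDerivAt_fst (𝕜 := ℝ) (p := z)).norm_sq).rpow_const (p := α)
    (Or.inl (by positivity))
  have h2 : (fun w : E m n => ‖w.1‖ ^ (2 * α)) = fun w => (‖w.1‖ ^ 2) ^ α := by
    funext w
    rw [Real.rpow_mul (norm_nonneg _)]
    norm_num
  rw [h2]
  refine h1.congr_fderiv ?_
  have h3 : (‖z.1‖ ^ 2) ^ (α - 1) = ‖z.1‖ ^ (2 * α - 2) := by
    rw [← Real.rpow_natCast, ← Real.rpow_mul h0.le]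
    congr 1
    push_cast
    ring
  rw [h3]
  ext v
  · simp
    ring
  · simp

lemma integrableOn_of_le_inv_norm_fst_sq (hm : 2 < m) {α r : ℝ} (hα : 0 < α) (hr : 0 < r)
    {f : E m n → ℝ} {C : ℝ}
    (hf : ContinuousOn f ({z | gaugePow α z < r ^ (2 * (α + 1))} ∩ {z | z.1 ≠ 0}))
    (hC : ∀ z, gaugePow α z < r ^ (2 * (α + 1)) → z.1 ≠ 0 → |f z| ≤ C * (‖z.1‖ ^ 2)⁻¹) :
    IntegrableOn f {z | gaugePow α z < r ^ (2 * (α + 1))} := by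
  have hR := contDiff_gaugePow (m := m) (n := n) hα
  set B := {z : E m n | gaugePow α z < r ^ (2 * (α + 1))} with hB
  have hBo : IsOpen B := isOpen_lt hR.continuous continuous_const
  have hX : IsOpen {z : E m n | z.1 ≠ 0} := isOpen_ne_fun continuous_fst continuous_const
  have hI : IntegrableOn (fun z : E m n => C * (‖z.1‖ ^ 2)⁻¹) B :=
    (integrableOn_inv_norm_fst_sq hm hα hr).const_mul C
  have hBX : (B ∩ {z : E m n | z.1 ≠ 0} : Set (E m n)) =ᵐ[volume] B := by
    filter_upwards [ae_fst_ne_zero (n := n) hm] with z hz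
    exact propext ⟨fun h => h.1, fun h => ⟨h, hz⟩⟩
  rw [← integrableOn_congr_set_ae hBX]
  refine Integrable.mono' (hI.mono_set Set.inter_subset_left)
    (hf.aestronglyMeasurable (hBo.inter hX).measurableSet) ?_
  exact (ae_restrict_iff' (hBo.inter hX).measurableSet).2
    (Filter.Eventually.of_forall fun z hz => hC z hz.1 hz.2)

lemma sq_fderiv_fst_le (L : E m n →L[ℝ] ℝ) (v : EuclideanSpace ℝ (Fin m)) :
    L (v, 0) ^ 2 ≤ ‖v‖ ^ 2 * ∑ i, L (EuclideanSpace.single i 1, 0) ^ 2 := by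
  rw [apply_fst_eq_sum, EuclideanSpace.real_norm_sq_eq]
  exact Finset.sum_mul_sq_le_sq_mul_sq _ _ _

lemma divg_fst (z : E m n) : divg (fun w : E m n => ((w.1, 0) : E m n)) z = m := by
  have h : HasFDerivAt (fun w : E m n => ((w.1, 0) : E m n))
      ((ContinuousLinearMap.fst ℝ (EuclideanSpace ℝ (Fin m)) (EuclideanSpace ℝ (Fin n))).prod 0)
      z := hasFDerivAt_fst.prodMk (hasFDerivAt_const _ _)
  unfold divg
  rw [h.fderiv]
  simp

/-- Local Hardy inequality with weight `|x|⁻²` on a gauge ball, for functions `p + |x|^{2α} q`. -/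
theorem integral_sq_div_norm_fst_sq_le (hm : 2 < m) {α r : ℝ} (hα : 0 < α) (hr : 0 < r)
    {U : Set (E m n)} (hU : IsOpen U) (hK : {z | gaugePow α z ≤ r ^ (2 * (α + 1))} ⊆ U)
    {p q g : E m n → ℝ} (hp : ContDiffOn ℝ 1 p U) (hq : ContDiffOn ℝ 1 q U)
    (hg : ∀ z, g z = p z + ‖z.1‖ ^ (2 * α) * q z) :
    IntegrableOn (fun z => g z ^ 2 * (‖z.1‖ ^ 2)⁻¹) {z | gaugePow α z < r ^ (2 * (α + 1))} ∧
    ∫ z in {z | gaugePow α z < r ^ (2 * (α + 1))}, g z ^ 2 * (‖z.1‖ ^ 2)⁻¹ ≤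
      4 / ((m : ℝ) - 2) ^ 2 *
        (∫ z in {z | gaugePow α z < r ^ (2 * (α + 1))}, gradXsq α g z) +
      7 / 2 / ((m : ℝ) - 2) * (r⁻¹ * ∫ z in (gsphere α r : Set (E m n)),
        g z ^ 2 * psi α z / normGradRho α z ∂μH[(m + n - 1 : ℝ)]) := by
  have hR := contDiff_gaugePow (m := m) (n := n) hα
  have hc : (0 : ℝ) < r ^ (2 * (α + 1)) := by positivity
  have hm' : (0 : ℝ) < m - 2 := by
    have : (2 : ℝ) < m := by exact_mod_cast hm
    linarith
  set c := r ^ (2 * (α + 1)) with hcdef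
  have hKc : IsCompact {z : E m n | gaugePow α z ≤ c} := isCompact_gaugePow_le hα hr
  have hX : IsOpen {z : E m n | z.1 ≠ 0} := isOpen_ne_fun continuous_fst continuous_const
  have hUX := hU.inter hX
  have hBU : {z : E m n | gaugePow α z < c} ⊆ U := 
    fun z hz => hK (show gaugePow α z ≤ c from le_of_lt hz)
  have hN : Continuous fun z : E m n => ‖z.1‖ ^ (2 * α) :=
    continuous_fst.norm.rpow_const fun _ => Or.inr (by positivity)
  have hgeq : g = fun z => p z + ‖z.1‖ ^ (2 * α) * q z := funext hg
  have hgc : ContinuousOn g U := by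
    rw [hgeq]
    exact hp.continuousOn.add (hN.continuousOn.mul hq.continuousOn)
  have hg1 : ContDiffOn ℝ 1 g (U ∩ {z | z.1 ≠ 0}) := by
    rw [hgeq]
    refine (hp.mono Set.inter_subset_left).add (ContDiffOn.mul ?_ (hq.mono Set.inter_subset_left))
    refine ContDiffOn.rpow_const_of_ne (contDiff_fst.contDiffOn.norm ℝ fun z hz => hz.2)
      fun z hz => norm_ne_zero_iff.2 hz.2
  have hgd : ContinuousOn (fderiv ℝ g) (U ∩ {z | z.1 ≠ 0}) :=
    hg1.continuousOn_fderiv_of_isOpen hUX le_rfl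
  have hgdat : ∀ z ∈ U, z.1 ≠ 0 → DifferentiableAt ℝ g z := fun z hz hx =>
    (hg1.contDiffAt (hUX.mem_nhds ⟨hz, hx⟩)).differentiableAt one_ne_zero
  obtain ⟨M₀, hM₀⟩ := hKc.exists_bound_of_continuousOn (hgc.mono hK)
  obtain ⟨M₁, hM₁⟩ := hKc.exists_bound_of_continuousOn
    ((hp.continuousOn_fderiv_of_isOpen hU le_rfl).mono hK)
  obtain ⟨M₂, hM₂⟩ := hKc.exists_bound_of_continuousOn (hq.continuousOn.mono hK)
  obtain ⟨M₃, hM₃⟩ := hKc.exists_bound_of_continuousOn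
    ((hq.continuousOn_fderiv_of_isOpen hU le_rfl).mono hK)
  obtain ⟨D, hD⟩ : ∃ D : ℝ, ∀ z : E m n, gaugePow α z < c → z.1 ≠ 0 →
      ‖z.1‖ * ‖fderiv ℝ g z‖ ≤ D := by
    refine ⟨r * M₁ + (2 * α * r ^ (2 * α)) * M₂ + r * r ^ (2 * α) * M₃, fun z hz hx => ?_⟩
    have hzU := hU.mem_nhds (hBU hz)
    have h1 := ((hp.contDiffAt hzU).differentiableAt one_ne_zero).hasFDerivAt
    have h2 := ((hq.contDiffAt hzU).differentiableAt one_ne_zero).hasFDerivAt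
    have h3 := hasFDerivAt_norm_fst_rpow α hx
    have h4 := (h1.add (h3.mul h2)).fderiv
    rw [show p + (fun w : E m n => ‖w.1‖ ^ (2 * α)) * q = g from hgeq.symm] at h4
    have hx0 : 0 < ‖z.1‖ := norm_pos_iff.2 hx
    have hxr : ‖z.1‖ ≤ r := norm_fst_le_of_gaugePow_le hα hr (le_of_lt hz)
    have hNr : ‖z.1‖ ^ (2 * α) ≤ r ^ (2 * α) := by gcongr
    have hN' : ‖z.1‖ * ‖(2 * α * ‖z.1‖ ^ (2 * α - 2)) • (innerSL ℝ z.1).comp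
        (ContinuousLinearMap.fst ℝ (EuclideanSpace ℝ (Fin m)) (EuclideanSpace ℝ (Fin n)))‖ ≤
        2 * α * r ^ (2 * α) := by
      have hle : ‖(innerSL ℝ z.1).comp
        (ContinuousLinearMap.fst ℝ (EuclideanSpace ℝ (Fin m)) (EuclideanSpace ℝ (Fin n)))‖ ≤
          ‖z.1‖ := by
        refine (ContinuousLinearMap.opNorm_comp_le _ _).trans ?_
        rw [innerSL_apply_norm]
        exact mul_le_of_le_one_right hx0.le (ContinuousLinearMap.norm_fst_le _ _ _)
      rw [norm_smul, Real.norm_of_nonneg (by positivity)]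
      calc _ ≤ ‖z.1‖ * (2 * α * ‖z.1‖ ^ (2 * α - 2) * ‖z.1‖) := by gcongr
        _ = 2 * α * (‖z.1‖ ^ (2 * α - 2) * ‖z.1‖ ^ 2) := by ring
        _ = 2 * α * ‖z.1‖ ^ (2 * α) := by
          rw [← Real.rpow_natCast, ← Real.rpow_add hx0]
          norm_num
        _ ≤ _ := by gcongr
    have hM₁' := hM₁ z (le_of_lt hz)
    have hM₂' := hM₂ z (le_of_lt hz)
    have hM₃' := hM₃ z (le_of_lt hz)
    have hM₁0 := (norm_nonneg _).trans hM₁'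
    have hM₂0 := (norm_nonneg _).trans hM₂'
    have hM₃0 := (norm_nonneg _).trans hM₃'
    rw [h4]
    calc _ ≤ ‖z.1‖ * (‖fderiv ℝ p z‖ + (‖z.1‖ ^ (2 * α) * ‖fderiv ℝ q z‖ +
          ‖q z‖ * ‖(2 * α * ‖z.1‖ ^ (2 * α - 2)) • (innerSL ℝ z.1).comp
        (ContinuousLinearMap.fst ℝ (EuclideanSpace ℝ (Fin m)) (EuclideanSpace ℝ (Fin n)))‖)) := by
          gcongr
          refine (norm_add_le _ _).trans ?_
          gcongr
          refine (norm_add_le _ _).trans ?_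
          rw [norm_smul, norm_smul, Real.norm_of_nonneg (by positivity : 0 ≤ ‖z.1‖ ^ (2 * α))]
      _ = ‖z.1‖ * ‖fderiv ℝ p z‖ + (‖z.1‖ * ‖(2 * α * ‖z.1‖ ^ (2 * α - 2)) • (innerSL ℝ z.1).comp
        (ContinuousLinearMap.fst ℝ (EuclideanSpace ℝ (Fin m)) (EuclideanSpace ℝ (Fin n)))‖) * ‖q z‖
          + ‖z.1‖ * ‖z.1‖ ^ (2 * α) * ‖fderiv ℝ q z‖ := by ring
      _ ≤ _ := by gcongr
  have hA : IntegrableOn (fun z : E m n => g z ^ 2 * (‖z.1‖ ^ 2)⁻¹) {z | gaugePow α z < c} := by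
    refine integrableOn_of_le_inv_norm_fst_sq hm hα hr (C := M₀ ^ 2) ?_ fun z hz hx => ?_
    · refine ((hgc.mono (Set.inter_subset_left.trans hBU)).pow 2).mul ?_
      exact (continuous_fst.norm.pow 2).continuousOn.inv₀ fun z hz => by simpa using hz.2
    · rw [abs_mul, abs_of_nonneg (by positivity : 0 ≤ (‖z.1‖ ^ 2)⁻¹), abs_of_nonneg (sq_nonneg _)]
      refine mul_le_mul_of_nonneg_right ?_ (by positivity)
      exact sq_le_sq' (abs_le.1 (hM₀ z (le_of_lt hz))).1 (abs_le.1 (hM₀ z (le_of_lt hz))).2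
  have hcontX : ContinuousOn (fun z : E m n => (‖z.1‖ ^ 2)⁻¹)
      ({z | gaugePow α z < c} ∩ {z | z.1 ≠ 0}) :=
    (continuous_fst.norm.pow 2).continuousOn.inv₀ fun z hz => by simpa using hz.2
  have hsubX : {z : E m n | gaugePow α z < c} ∩ {z | z.1 ≠ 0} ⊆ U ∩ {z | z.1 ≠ 0} :=
    Set.inter_subset_inter_left _ hBU
  have happ : ∀ (z v : E m n), gaugePow α z < c → z.1 ≠ 0 → ‖v‖ ≤ 1 →
      (fderiv ℝ g z v) ^ 2 ≤ D ^ 2 * (‖z.1‖ ^ 2)⁻¹ := by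
    intro z v hz hx hv
    have hx0 : 0 < ‖z.1‖ := norm_pos_iff.2 hx
    have h1 : ‖fderiv ℝ g z v‖ ≤ ‖fderiv ℝ g z‖ :=
      (ContinuousLinearMap.le_opNorm _ _).trans (mul_le_of_le_one_right (norm_nonneg _) hv)
    rw [← div_eq_mul_inv, le_div_iff₀ (by positivity), ← mul_pow, ← sq_abs, abs_mul,
      abs_of_pos hx0, ← Real.norm_eq_abs]
    have h2 := hD z hz hx
    gcongr
    nlinarith
  have hG : IntegrableOn (gradXsq α g) {z : E m n | gaugePow α z < c} := by
    refine integrableOn_of_le_inv_norm_fst_sq hm hα hr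
      (C := m * D ^ 2 + r ^ (2 * α) * (n * D ^ 2)) ?_ fun z hz hx => ?_
    · unfold gradXsq
      refine ContinuousOn.add (continuousOn_finsetSum _ fun i _ => ?_)
        (hN.continuousOn.mul (continuousOn_finsetSum _ fun i _ => ?_)) <;>
      exact ((hgd.mono hsubX).clm_apply continuousOn_const).pow 2
    · have hxr : ‖z.1‖ ≤ r := norm_fst_le_of_gaugePow_le hα hr (le_of_lt hz)
      have hNr : ‖z.1‖ ^ (2 * α) ≤ r ^ (2 * α) := by gcongr
      unfold gradXsq
      rw [abs_of_nonneg (by positivity)]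
      have h1 : ∑ i, (fderiv ℝ g z (EuclideanSpace.single i 1, 0)) ^ 2 ≤
          m * (D ^ 2 * (‖z.1‖ ^ 2)⁻¹) := by
        refine (Finset.sum_le_card_nsmul _ _ _ fun i _ => happ z _ hz hx ?_).trans ?_
        · simp [Prod.norm_def]
        · simp
      have h2 : ∑ j, (fderiv ℝ g z (0, EuclideanSpace.single j 1)) ^ 2 ≤
          n * (D ^ 2 * (‖z.1‖ ^ 2)⁻¹) := by
        refine (Finset.sum_le_card_nsmul _ _ _ fun i _ => happ z _ hz hx ?_).trans ?_
        · simp [Prod.norm_def]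
        · simp
      calc _ ≤ m * (D ^ 2 * (‖z.1‖ ^ 2)⁻¹) + r ^ (2 * α) * (n * (D ^ 2 * (‖z.1‖ ^ 2)⁻¹)) := by
            gcongr
        _ = _ := by ring
  have hT : IntegrableOn (fun z : E m n => 2 * g z * fderiv ℝ g z (z.1, 0) * (‖z.1‖ ^ 2)⁻¹)
      {z : E m n | gaugePow α z < c} := by
    refine integrableOn_of_le_inv_norm_fst_sq hm hα hr (C := 2 * M₀ * D) ?_ fun z hz hx => ?_
    · refine ContinuousOn.mul (ContinuousOn.mul (continuousOn_const.mul
        (hgc.mono (Set.inter_subset_left.trans hBU))) ?_) hcontX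
      exact (hgd.mono hsubX).clm_apply (continuous_fst.prodMk continuous_const).continuousOn
    · rw [abs_mul, abs_of_nonneg (by positivity : 0 ≤ (‖z.1‖ ^ 2)⁻¹), abs_mul, abs_mul, abs_two]
      have h0 := hM₀ z (le_of_lt hz)
      rw [Real.norm_eq_abs] at h0
      have h0' := (abs_nonneg _).trans h0
      gcongr
      rw [← Real.norm_eq_abs]
      refine (ContinuousLinearMap.le_opNorm _ _).trans ((le_of_eq ?_).trans (hD z hz hx))
      simp [Prod.norm_def, mul_comm]
  set F : E m n → E m n := fun z => (g z ^ 2 * (‖z.1‖ ^ 2)⁻¹) • ((z.1, 0) : E m n) with hF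
  set d : E m n → ℝ := fun z => (m - 2) * (g z ^ 2 * (‖z.1‖ ^ 2)⁻¹) +
    2 * g z * fderiv ℝ g z (z.1, 0) * (‖z.1‖ ^ 2)⁻¹ with hd
  have hdi : IntegrableOn d {z : E m n | gaugePow α z < c} := (hA.const_mul _).add hT
  have key := ofReal_integral_divergence_le hR (b := c / 2) (c := c) (by linarith) hKc
    (fun z hz _ => fderiv_gaugePow_ne_zero hα (by linarith)) hU hK hU (fun z hz => hK hz.2)
    (F := F) (C := M₀ ^ 2) (d := d) (H := fun z => 2 * (α + 1) * ‖z.1‖ ^ (2 * α) * g z ^ 2)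
    ?_ ?_ hdi ?_ ?_ ?_ (integrableOn_inv_norm_fst_sq hm hα hr) (ae_fst_ne_zero hm)
  · rw [setLIntegral_gsphere hα hr (f := fun z => g z ^ 2)
      ((hgc.mono fun z hz => hK (show gaugePow α z ≤ c from le_of_eq hz)).pow 2)
      fun z => sq_nonneg _] at key
    rw [← ENNReal.ofReal_mul (by norm_num), ENNReal.ofReal_le_ofReal_iff
      (mul_nonneg (by norm_num) (mul_nonneg (by positivity)
        (integral_gsphere_nonneg fun z => sq_nonneg _)))] at key
    refine ⟨hA, ?_⟩
    have hlow : ∫ z in {z : E m n | gaugePow α z < c},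
        ((m - 2) / 2 * (g z ^ 2 * (‖z.1‖ ^ 2)⁻¹) - 2 / (m - 2) * gradXsq α g z) ≤
        ∫ z in {z : E m n | gaugePow α z < c}, d z := by
      refine integral_mono ((hA.const_mul _).sub (hG.const_mul _)) hdi fun z => ?_
      have h1 : fderiv ℝ g z (z.1, 0) ^ 2 * (‖z.1‖ ^ 2)⁻¹ ≤ gradXsq α g z := by
        have h2 := sq_fderiv_fst_le (fderiv ℝ g z) z.1
        have h3 : ∑ i, (fderiv ℝ g z (EuclideanSpace.single i 1, 0)) ^ 2 ≤ gradXsq α g z :=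
          le_add_of_nonneg_right (by positivity)
        refine le_trans ?_ h3
        rcases eq_or_ne z.1 0 with hx | hx
        · rw [hx]
          simp only [norm_zero]
          norm_num
          positivity
        · rwa [← div_eq_mul_inv, div_le_iff₀' (by positivity)]
      have h4 : 0 ≤ ((m - 2) * g z + 2 * fderiv ℝ g z (z.1, 0)) ^ 2 * (‖z.1‖ ^ 2)⁻¹ := by
        positivity
      have h5 : 2 / ((m : ℝ) - 2) * (fderiv ℝ g z (z.1, 0) ^ 2 * (‖z.1‖ ^ 2)⁻¹) ≤
          2 / (m - 2) * gradXsq α g z := by gcongr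
      have h6 : ((m : ℝ) - 2) / 2 * (g z ^ 2 * (‖z.1‖ ^ 2)⁻¹) +
          2 * g z * fderiv ℝ g z (z.1, 0) * (‖z.1‖ ^ 2)⁻¹ +
          2 / (m - 2) * (fderiv ℝ g z (z.1, 0) ^ 2 * (‖z.1‖ ^ 2)⁻¹) =
          (((m - 2) * g z + 2 * fderiv ℝ g z (z.1, 0)) ^ 2 * (‖z.1‖ ^ 2)⁻¹) / (2 * (m - 2)) := by
        generalize (‖z.1‖ ^ 2)⁻¹ = w
        field_simp
        ring
      have h7 := div_nonneg h4 (by positivity : 0 ≤ 2 * ((m : ℝ) - 2))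
      simp only [hd]
      linarith
    rw [integral_sub (hA.const_mul _) (hG.const_mul _), integral_const_mul,
      integral_const_mul] at hlow
    have := hlow.trans key
    set A := ∫ z in {z : E m n | gaugePow α z < c}, g z ^ 2 * (‖z.1‖ ^ 2)⁻¹
    set G := ∫ z in {z : E m n | gaugePow α z < c}, gradXsq α g z
    have h8 : A = 2 / (m - 2) * ((m - 2) / 2 * A - 2 / (m - 2) * G) + 4 / ((m : ℝ) - 2) ^ 2 * G := by
      field_simp
      ring
    have h9 := mul_le_mul_of_nonneg_left this (by positivity : 0 ≤ 2 / ((m : ℝ) - 2))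
    rw [h8]
    refine (add_le_add_left h9 _).trans (le_of_eq ?_)
    ring
  · refine ContDiffOn.smul (ContDiffOn.mul (hg1.pow 2) (ContDiffOn.inv ?_ fun z hz => ?_))
      (contDiff_fst.prodMk contDiff_const).contDiffOn
    · exact (contDiff_fst.norm_sq ℝ).contDiffOn
    · simpa using hz.2
  · intro z hz hx
    have hx0 : 0 < ‖z.1‖ := norm_pos_iff.2 hx
    have h0 := hM₀ z (le_of_lt hz)
    have : ‖z.1‖ * ‖(F z).1‖ = ‖g z‖ ^ 2 := by
      simp only [hF, Prod.smul_fst, norm_smul, norm_mul, norm_inv, norm_pow, norm_norm]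
      field_simp
    rw [this]
    gcongr
  · intro z hz hx
    have hx0 : 0 < ‖z.1‖ := norm_pos_iff.2 hx
    have h1 := (hgdat z (hBU hz) hx).hasFDerivAt
    have h2 := ((hasFDerivAt_fst (𝕜 := ℝ) (p := z)).norm_sq)
    have h3 := (h1.pow 2).mul ((hasDerivAt_inv (by positivity : ‖z.1‖ ^ 2 ≠ 0)).comp_hasFDerivAt z h2)
    have h4 := divg_smul (F := fun w : E m n => ((w.1, 0) : E m n)) h3 (by fun_prop)
    rw [divg_fst] at h4
    refine h4.trans ?_
    simp [hd]
    field_simp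
    ring
  · exact (continuous_const.mul hN).continuousOn.mul (hgc.pow 2)
  · intro z hz hzc hx
    have hx0 : 0 < ‖z.1‖ := norm_pos_iff.2 hx
    rw [fderiv_gaugePow_apply hα]
    simp only [hF, Prod.smul_mk, smul_zero, inner_zero_right, inner_smul_right,
      real_inner_self_eq_norm_sq, mul_zero, add_zero]
    field_simp

end Hardy

section Fields

variable {m n : ℕ}

lemma contDiffOn_fderiv_apply {U : Set (E m n)} (hU : IsOpen U) {u : E m n → ℝ}
    (hu : ContDiffOn ℝ (⊤ : ℕ∞) u U) (v : E m n) :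
    ContDiffOn ℝ (⊤ : ℕ∞) (fun w => fderiv ℝ u w v) U :=
  (hu.fderiv_of_isOpen hU (by simp)).clm_apply contDiffOn_const

/-- The vector field `(∇_x u, |x|^{2α} ∇_y u)`, whose divergence is `Δ_X u`. -/
def gradField (α : ℝ) (u : E m n → ℝ) (z : E m n) : E m n :=
  (WithLp.toLp 2 fun i => fderiv ℝ u z (EuclideanSpace.single i 1, 0),
    ‖z.1‖ ^ (2 * α) • WithLp.toLp 2 fun j => fderiv ℝ u z (0, EuclideanSpace.single j 1))

/-- The generator `(x, (α+1) y)` of the anisotropic dilations. -/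
def dilationField (α : ℝ) (z : E m n) : E m n := (z.1, (α + 1) • z.2)

lemma continuousOn_gradField {α : ℝ} (hα : 0 < α) {U : Set (E m n)} (hU : IsOpen U)
    {u : E m n → ℝ} (hu : ContDiffOn ℝ (⊤ : ℕ∞) u U) : ContinuousOn (gradField α u) U := by
  refine ContinuousOn.prodMk ?_ (ContinuousOn.fun_smul ?_ ?_)
  · exact (PiLp.continuous_toLp 2 _).comp_continuousOn
      (continuousOn_pi.2 fun i => (contDiffOn_fderiv_apply hU hu _).continuousOn)
  · exact (continuous_fst.norm.rpow_const fun _ => Or.inr (by positivity)).continuousOn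
  · exact (PiLp.continuous_toLp 2 _).comp_continuousOn
      (continuousOn_pi.2 fun i => (contDiffOn_fderiv_apply hU hu _).continuousOn)

lemma contDiffOn_gradField {α : ℝ} {U : Set (E m n)} (hU : IsOpen U)
    {u : E m n → ℝ} (hu : ContDiffOn ℝ (⊤ : ℕ∞) u U) :
    ContDiffOn ℝ 1 (gradField α u) (U ∩ {z | z.1 ≠ 0}) := by
  have h : ∀ v, ContDiffOn ℝ 1 (fun w => fderiv ℝ u w v) (U ∩ {z | z.1 ≠ 0}) := fun v =>
    ((contDiffOn_fderiv_apply hU hu v).of_le (by exact_mod_cast le_top)).mono Set.inter_subset_left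
  refine ContDiffOn.prodMk ?_ (ContDiffOn.fun_smul ?_ ?_)
  · exact (contDiffOn_piLp 2).2 fun i => h _
  · exact ContDiffOn.rpow_const_of_ne (contDiff_fst.contDiffOn.norm ℝ fun z hz => hz.2)
      fun z hz => norm_ne_zero_iff.2 hz.2
  · exact (contDiffOn_piLp 2).2 fun i => h _

lemma divg_gradField {α : ℝ} {U : Set (E m n)} (hU : IsOpen U)
    {u : E m n → ℝ} (hu : ContDiffOn ℝ (⊤ : ℕ∞) u U) {z : E m n} (hz : z ∈ U) (hx : z.1 ≠ 0) :
    divg (gradField α u) z = lapX α u z := by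
  have hX : IsOpen {z : E m n | z.1 ≠ 0} := isOpen_ne_fun continuous_fst continuous_const
  have hd : DifferentiableAt ℝ (gradField α u) z :=
    ((contDiffOn_gradField hU hu).contDiffAt ((hU.inter hX).mem_nhds ⟨hz, hx⟩)).differentiableAt
      one_ne_zero
  unfold divg lapX
  congr 1
  · refine Finset.sum_congr rfl fun i _ => ?_
    rw [fderiv_fst_apply hd]
    rfl
  · rw [Finset.mul_sum]
    refine Finset.sum_congr rfl fun j _ => ?_
    rw [fderiv_snd_apply hd]
    have h1 := hasFDerivAt_norm_fst_rpow α hx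
    have h2 := (((contDiffOn_fderiv_apply hU hu (0, EuclideanSpace.single j 1)).contDiffAt
      (hU.mem_nhds hz)).differentiableAt (by simp)).hasFDerivAt
    have h3 := (h1.mul h2).fderiv
    have h4 : (fun w => (gradField α u w).2 j) = (fun w : E m n => ‖w.1‖ ^ (2 * α)) *
        fun w => fderiv ℝ u w (0, EuclideanSpace.single j 1) := by
      funext w
      simp [gradField]
    rw [h4, h3]
    simp

lemma divg_dilationField (α : ℝ) (z : E m n) :
    divg (dilationField α) z = (m : ℝ) + (α + 1) * n := by
  have h : HasFDerivAt (dilationField α : E m n → E m n)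
      ((ContinuousLinearMap.fst ℝ (EuclideanSpace ℝ (Fin m)) (EuclideanSpace ℝ (Fin n))).prod
        ((α + 1) • ContinuousLinearMap.snd ℝ (EuclideanSpace ℝ (Fin m))
          (EuclideanSpace ℝ (Fin n)))) z :=
    hasFDerivAt_fst.prodMk (hasFDerivAt_snd.fun_const_smul _)
  unfold divg
  rw [h.fderiv]
  simp
  ring

lemma divg_add {F G : E m n → E m n} {z : E m n} (hF : DifferentiableAt ℝ F z)
    (hG : DifferentiableAt ℝ G z) :
    divg (fun w => F w + G w) z = divg F z + divg G z := by
  unfold divg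
  rw [fderiv_fun_add hF hG]
  simp only [_root_.add_apply, Prod.fst_add, Prod.snd_add, PiLp.add_apply, Finset.sum_add_distrib]
  ring

lemma apply_eq_sum (L : E m n →L[ℝ] ℝ) (v : E m n) :
    L v = ∑ i, v.1 i * L (EuclideanSpace.single i 1, 0) +
      ∑ j, v.2 j * L (0, EuclideanSpace.single j 1) := by
  rw [← apply_fst_eq_sum, ← apply_snd_eq_sum, ← map_add]
  simp

lemma fderiv_apply_gradField (α : ℝ) (u : E m n → ℝ) (z : E m n) :
    fderiv ℝ u z (gradField α u z) = gradXsq α u z := by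
  rw [apply_eq_sum]
  simp [gradField, gradXsq, Finset.mul_sum, sq, mul_assoc]

lemma fderiv_gaugePow_gradField {α : ℝ} (hα : 0 < α) (u : E m n → ℝ) (z : E m n) :
    fderiv ℝ (gaugePow α) z (gradField α u z) =
      2 * (α + 1) * ‖z.1‖ ^ (2 * α) * Zop α u z := by
  rw [fderiv_gaugePow_apply hα, Zop, apply_eq_sum]
  simp only [gradField, PiLp.inner_apply, PiLp.smul_apply, smul_eq_mul, Real.inner_apply,
    mul_add, Finset.mul_sum]
  congr 1
  refine Finset.sum_congr rfl fun i _ => ?_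
  simp
  ring

lemma fderiv_gaugePow_dilationField {α : ℝ} (hα : 0 < α) (z : E m n) :
    fderiv ℝ (gaugePow α) z (dilationField α z) = 2 * (α + 1) * gaugePow α z := by
  rw [fderiv_gaugePow_apply hα]
  simp only [dilationField, inner_smul_right, real_inner_self_eq_norm_sq, gaugePow,
    rpow_two_mul_add_one (norm_nonneg z.1) hα]
  ring

end Fields

section Rellich

variable {m n : ℕ}

lemma sq_mul_rpow_neg_sq_le {α X T : ℝ} (hα : 0 < α) (hα1 : α ≤ 1) (hX : 0 < X)
    (hT : X ^ (2 * (α + 1)) ≤ T) :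
    X ^ 2 * (T ^ (-(2 / (α + 1)))) ^ 2 ≤ X ^ (2 * α) * T ^ (-(2 / (α + 1) + 1)) := by
  have hT0 : 0 < T := lt_of_lt_of_le (by positivity) hT
  have h1 : X ^ (2 - 2 * α) ≤ T ^ ((1 - α) / (α + 1)) := by
    calc X ^ (2 - 2 * α) = (X ^ (2 * (α + 1))) ^ ((1 - α) / (α + 1)) := by
          rw [← Real.rpow_mul hX.le]
          congr 1
          field_simp
      _ ≤ _ := Real.rpow_le_rpow (by positivity) hT (div_nonneg (by linarith) (by linarith))
  have h2 : X ^ 2 = X ^ (2 * α) * X ^ (2 - 2 * α) := by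
    rw [← Real.rpow_add hX, ← Real.rpow_natCast]
    congr 1
    push_cast
    ring
  have h3 : T ^ (-(2 / (α + 1) + 1)) =
      T ^ ((1 - α) / (α + 1)) * (T ^ (-(2 / (α + 1)))) ^ 2 := by
    rw [← Real.rpow_natCast, ← Real.rpow_mul hT0.le, ← Real.rpow_add hT0]
    congr 1
    field_simp
    push_cast
    ring
  rw [h2, h3, mul_assoc]
  gcongr

lemma neg_le_two_mul_mul_mul {X w u g M q : ℝ} (hX : 0 < X) (hq : 0 < q)
    (hM : X ^ 2 * w ^ 2 ≤ M) :
    -(q / 2 * (u ^ 2 * M) + 2 / q * (g ^ 2 * (X ^ 2)⁻¹)) ≤ 2 * (u * w * g) := by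
  have h1 : q / 2 * (u ^ 2 * (X ^ 2 * w ^ 2)) ≤ q / 2 * (u ^ 2 * M) := by gcongr
  have h2 : q / 2 * (u ^ 2 * (X ^ 2 * w ^ 2)) + 2 / q * (g ^ 2 * (X ^ 2)⁻¹) + 2 * (u * w * g) =
      (q * u * X ^ 2 * w + 2 * g) ^ 2 / (2 * q * X ^ 2) := by
    field_simp
    ring
  have h3 : 0 ≤ (q * u * X ^ 2 * w + 2 * g) ^ 2 / (2 * q * X ^ 2) := by positivity
  linarith

/-- Regularized local Rellich inequality on a gauge ball. -/
theorem integral_sq_mul_gaugePow_add_le (hm : 2 < m) {α r : ℝ} (hα : 0 < α) (hα1 : α ≤ 1)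
    (hQ : 6 < (m : ℝ) + (α + 1) * n) (hr : 0 < r)
    {U : Set (E m n)} (hU : IsOpen U) (hK : {z | gaugePow α z ≤ r ^ (2 * (α + 1))} ⊆ U)
    {u : E m n → ℝ} (hu : ContDiffOn ℝ (⊤ : ℕ∞) u U)
    (hA : IntegrableOn (fun z => lapX α u z ^ 2 * (‖z.1‖ ^ 2)⁻¹)
      {z | gaugePow α z < r ^ (2 * (α + 1))})
    {τ : ℝ} (hτ : 0 < τ) :
    IntegrableOn (fun z => u z ^ 2 * (‖z.1‖ ^ (2 * α) *
      (gaugePow α z + τ) ^ (-(2 / (α + 1) + 1)))) {z | gaugePow α z < r ^ (2 * (α + 1))} ∧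
    ∫ z in {z | gaugePow α z < r ^ (2 * (α + 1))}, u z ^ 2 * (‖z.1‖ ^ (2 * α) *
      (gaugePow α z + τ) ^ (-(2 / (α + 1) + 1))) ≤
      2 / ((m : ℝ) + (α + 1) * n - 6) * (r⁻¹ * r⁻¹ ^ 4 * ∫ z in (gsphere α r : Set (E m n)),
        u z ^ 2 * psi α z / normGradRho α z ∂μH[(m + n - 1 : ℝ)]) +
      4 / 7 / ((m : ℝ) + (α + 1) * n - 6) ^ 2 *
        ∫ z in {z | gaugePow α z < r ^ (2 * (α + 1))}, lapX α u z ^ 2 * (‖z.1‖ ^ 2)⁻¹ := by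
  have hR := contDiff_gaugePow (m := m) (n := n) hα
  have hc : (0 : ℝ) < r ^ (2 * (α + 1)) := by positivity
  obtain ⟨q, hq⟩ : ∃ q, q = (m : ℝ) + (α + 1) * n - 6 := ⟨_, rfl⟩
  have hq0 : 0 < q := by linarith
  rw [← hq]
  obtain ⟨e, he⟩ : ∃ e, e = 2 / (α + 1) := ⟨_, rfl⟩
  have he0 : 0 < e := by rw [he]; positivity
  have heβ : e * (α + 1) = 2 := by rw [he]; field_simp
  have hamgm : ∀ {X T : ℝ}, 0 < X → X ^ (2 * (α + 1)) ≤ T →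
      X ^ 2 * (T ^ (-e)) ^ 2 ≤ X ^ (2 * α) * T ^ (-(e + 1)) := by
    intro X T hX hT
    rw [he]
    exact sq_mul_rpow_neg_sq_le hα hα1 hX hT
  have hcr : (r ^ (2 * (α + 1))) ^ (-e) = r⁻¹ ^ 4 := by
    rw [← Real.rpow_mul hr.le, show 2 * (α + 1) * -e = -((4 : ℕ) : ℝ) by push_cast; linarith,
      Real.rpow_neg hr.le, Real.rpow_natCast, inv_pow]
  rw [← he]
  set c := r ^ (2 * (α + 1)) with hcdef
  set g := lapX α u with hg
  have hKc : IsCompact {z : E m n | gaugePow α z ≤ c} := isCompact_gaugePow_le hα hr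
  have hX : IsOpen {z : E m n | z.1 ≠ 0} := isOpen_ne_fun continuous_fst continuous_const
  have hBK : {z : E m n | gaugePow α z < c} ⊆ {z | gaugePow α z ≤ c} :=
    fun z hz => le_of_lt (show gaugePow α z < c from hz)
  have hBU := hBK.trans hK
  have hN : Continuous fun z : E m n => ‖z.1‖ ^ (2 * α) :=
    continuous_fst.norm.rpow_const fun _ => Or.inr (by positivity)
  have hTpos : ∀ z : E m n, 0 < gaugePow α z + τ := fun z => by
    have := gaugePow_nonneg α z
    linarith
  have hTc : ∀ k : ℝ, Continuous fun z : E m n => (gaugePow α z + τ) ^ k := fun k =>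
    (hR.continuous.add continuous_const).rpow_const fun z => Or.inl (hTpos z).ne'
  set W : E m n → ℝ := fun z => (gaugePow α z + τ) ^ (-e) - (c + τ) ^ (-e) with hW
  have hWc : Continuous W := (hTc _).sub continuous_const
  have hfd : ∀ v, ContinuousOn (fun w => fderiv ℝ u w v) U := fun v =>
    (contDiffOn_fderiv_apply hU hu v).continuousOn
  have hgc : ContinuousOn g U := by
    refine ContinuousOn.add (continuousOn_finsetSum _ fun i _ => ?_)
      (hN.continuousOn.mul (continuousOn_finsetSum _ fun i _ => ?_)) <;>
    exact (contDiffOn_fderiv_apply hU (contDiffOn_fderiv_apply hU hu _) _).continuousOn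
  have hGc : ContinuousOn (gradXsq α u) U := by
    refine ContinuousOn.add (continuousOn_finsetSum _ fun i _ => ?_)
      (hN.continuousOn.mul (continuousOn_finsetSum _ fun i _ => ?_)) <;>
    exact (hfd _).pow 2
  have hDc : Continuous (dilationField α : E m n → E m n) :=
    continuous_fst.prodMk (continuous_snd.const_smul (α + 1))
  have hZc : ContinuousOn (Zop α u) U :=
    (hu.continuousOn_fderiv_of_isOpen hU (by simp)).clm_apply hDc.continuousOn
  have hcontInt : ∀ f : E m n → ℝ, ContinuousOn f U →
      IntegrableOn f {z : E m n | gaugePow α z < c} := by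
    intro f hf
    have := isAddHaarMeasure_volume_prod (m := m) (n := n)
    exact ((hf.mono hK).integrableOn_compact hKc).mono_set hBK
  have hL : IntegrableOn (fun z : E m n => u z ^ 2 * (‖z.1‖ ^ (2 * α) *
      (gaugePow α z + τ) ^ (-(e + 1)))) {z | gaugePow α z < c} :=
    hcontInt _ ((hu.continuousOn.pow 2).mul (hN.mul (hTc _)).continuousOn)
  refine ⟨hL, ?_⟩
  set F : E m n → E m n := fun z => (2 * (u z * W z)) • gradField α u z +
    (4 * (u z ^ 2 * (‖z.1‖ ^ (2 * α) * (gaugePow α z + τ) ^ (-(e + 1))))) •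
      dilationField α z with hF
  have hFc : ContinuousOn F U :=
    ((continuousOn_const.mul (hu.continuousOn.mul hWc.continuousOn)).smul
      (continuousOn_gradField hα hU hu)).add
    ((continuousOn_const.mul ((hu.continuousOn.pow 2).mul (hN.mul (hTc _)).continuousOn)).smul
      hDc.continuousOn)
  obtain ⟨M, hM⟩ := hKc.exists_bound_of_continuousOn (hFc.mono hK)
  set d : E m n → ℝ := fun z => 2 * (u z * W z * g z) + 2 * (W z * gradXsq α u z) +
    4 * (u z ^ 2 * (‖z.1‖ ^ (2 * α) * ((q + 6 + 2 * α) * (gaugePow α z + τ) ^ (-(e + 1)) -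
      2 * (α + 3) * (gaugePow α z * (gaugePow α z + τ) ^ (-(e + 1) - 1))))) with hd
  have hdi : IntegrableOn d {z : E m n | gaugePow α z < c} := by
    refine hcontInt _ ?_
    refine ((continuousOn_const.mul ((hu.continuousOn.mul hWc.continuousOn).mul hgc)).add
      (continuousOn_const.mul (hWc.continuousOn.mul hGc))).add
      (continuousOn_const.mul ((hu.continuousOn.pow 2).mul (hN.mul ?_).continuousOn))
    exact (continuous_const.mul (hTc _)).sub
      (continuous_const.mul (hR.continuous.mul (hTc _)))
  set H : E m n → ℝ := fun z => 2 * (u z * W z) * (2 * (α + 1) * ‖z.1‖ ^ (2 * α) * Zop α u z) +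
    4 * (u z ^ 2 * (‖z.1‖ ^ (2 * α) * (gaugePow α z + τ) ^ (-(e + 1)))) *
      (2 * (α + 1) * gaugePow α z) with hH
  have key := ofReal_integral_divergence_le hR (b := c / 2) (c := c) (by linarith) hKc
    (fun z hz _ => fderiv_gaugePow_ne_zero hα (by linarith)) hU hK hU (fun z hz => hK hz.2)
    (F := F) (C := r * M) (d := d) (H := H)
    ?_ ?_ hdi ?_ ?_ ?_ (integrableOn_inv_norm_fst_sq hm hα hr) (ae_fst_ne_zero hm)
  · have hbd : ∫⁻ z in {z : E m n | gaugePow α z = c},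
        ENNReal.ofReal (H z / gradNorm (gaugePow α) z) ∂μH[(m + n - 1 : ℝ)] ≤
        ∫⁻ z in {z : E m n | gaugePow α z = c},
        ENNReal.ofReal ((2 * (α + 1) * ‖z.1‖ ^ (2 * α) * (4 * r⁻¹ ^ 4 * u z ^ 2)) /
          gradNorm (gaugePow α) z) ∂μH[(m + n - 1 : ℝ)] := by
      refine setLIntegral_mono_ae' (hR.continuous.measurable (measurableSet_singleton c)) ?_
      refine Filter.Eventually.of_forall fun z hz => ?_
      have hz' : gaugePow α z = c := hz
      have h1 : c * (c + τ) ^ (-(e + 1)) ≤ r⁻¹ ^ 4 := by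
        rw [← hcr]
        calc c * (c + τ) ^ (-(e + 1)) ≤ c * c ^ (-(e + 1)) := by
              refine mul_le_mul_of_nonneg_left ?_ hc.le
              exact Real.rpow_le_rpow_of_nonpos hc (by linarith) (by linarith)
          _ = c ^ (-e) := by
              rw [show -e = 1 + -(e + 1) by ring, Real.rpow_add hc, Real.rpow_one]
      refine ENNReal.ofReal_le_ofReal (div_le_div_of_nonneg_right ?_ (Real.sqrt_nonneg _))
      simp only [hH, hW, hz', sub_self, mul_zero, zero_mul, zero_add]
      calc _ = 2 * (α + 1) * ‖z.1‖ ^ (2 * α) * (4 * (c * (c + τ) ^ (-(e + 1))) * u z ^ 2) := by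
            ring
        _ ≤ _ := by gcongr
    replace key := key.trans (mul_le_mul_right hbd _)
    rw [setLIntegral_gsphere hα hr (f := fun z => 4 * r⁻¹ ^ 4 * u z ^ 2)
      (continuousOn_const.mul
        ((hu.continuousOn.mono fun z hz => hK (show gaugePow α z ≤ c from le_of_eq hz)).pow 2))
      fun z => by positivity,
      ← ENNReal.ofReal_mul (by norm_num), ENNReal.ofReal_le_ofReal_iff
      (mul_nonneg (by norm_num) (mul_nonneg (by positivity)
        (integral_gsphere_nonneg fun z => by positivity)))] at key
    have hlow : ∫ z in {z : E m n | gaugePow α z < c},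
        (7 / 2 * q * (u z ^ 2 * (‖z.1‖ ^ (2 * α) * (gaugePow α z + τ) ^ (-(e + 1)))) -
          2 / q * (g z ^ 2 * (‖z.1‖ ^ 2)⁻¹)) ≤
        ∫ z in {z : E m n | gaugePow α z < c}, d z := by
      have hBm : MeasurableSet {z : E m n | gaugePow α z < c} :=
        (isOpen_lt hR.continuous continuous_const).measurableSet
      refine setIntegral_mono_on_ae ((hL.const_mul _).sub (hA.const_mul _)) hdi hBm ?_
      filter_upwards [ae_fst_ne_zero (n := n) hm] with z hx hz
      have hz' : gaugePow α z < c := hz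
      have hx0 : 0 < ‖z.1‖ := norm_pos_iff.2 hx
      have hT := hTpos z
      have hR0 := gaugePow_nonneg α z
      have hW0 : 0 ≤ W z := sub_nonneg.2
        (Real.rpow_le_rpow_of_nonpos hT (by linarith) (by linarith))
      have hWle : W z ≤ (gaugePow α z + τ) ^ (-e) := sub_le_self _ (by positivity)
      have h1 : ‖z.1‖ ^ 2 * W z ^ 2 ≤ ‖z.1‖ ^ (2 * α) * (gaugePow α z + τ) ^ (-(e + 1)) := by
        refine le_trans (by gcongr) (hamgm hx0 ?_)
        have : ‖z.1‖ ^ (2 * (α + 1)) ≤ gaugePow α z := le_add_of_nonneg_right (by positivity)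
        linarith
      have h2 := neg_le_two_mul_mul_mul (u := u z) (g := g z) hx0 hq0 h1
      have h3 : 0 ≤ W z * gradXsq α u z := mul_nonneg hW0 (by unfold gradXsq; positivity)
      have h4 : gaugePow α z * (gaugePow α z + τ) ^ (-(e + 1) - 1) ≤
          (gaugePow α z + τ) ^ (-(e + 1)) := by
        rw [Real.rpow_sub_one hT.ne', mul_div_assoc', div_le_iff₀ hT, mul_comm]
        gcongr
        linarith
      have h5 : u z ^ 2 * (‖z.1‖ ^ (2 * α) * (q * (gaugePow α z + τ) ^ (-(e + 1)))) ≤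
          u z ^ 2 * (‖z.1‖ ^ (2 * α) * ((q + 6 + 2 * α) * (gaugePow α z + τ) ^ (-(e + 1)) -
      2 * (α + 3) * (gaugePow α z * (gaugePow α z + τ) ^ (-(e + 1) - 1)))) := by
        have h6 := mul_le_mul_of_nonneg_left h4 (by positivity : 0 ≤ 2 * (α + 3))
        gcongr
        linarith
      simp only [hd]
      linarith
    rw [integral_sub (hL.const_mul _) (hA.const_mul _), integral_const_mul,
      integral_const_mul] at hlow
    have h7 := hlow.trans key
    have h8 : ∫ z in (gsphere α r : Set (E m n)),
        4 * r⁻¹ ^ 4 * u z ^ 2 * psi α z / normGradRho α z ∂μH[(m + n - 1 : ℝ)] =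
        4 * r⁻¹ ^ 4 * ∫ z in (gsphere α r : Set (E m n)),
          u z ^ 2 * psi α z / normGradRho α z ∂μH[(m + n - 1 : ℝ)] := by
      rw [← integral_const_mul]
      congr 1
      funext z
      ring
    rw [h8] at h7
    set L := ∫ z in {z : E m n | gaugePow α z < c},
      u z ^ 2 * (‖z.1‖ ^ (2 * α) * (gaugePow α z + τ) ^ (-(e + 1)))
    set A := ∫ z in {z : E m n | gaugePow α z < c}, g z ^ 2 * (‖z.1‖ ^ 2)⁻¹
    have h9 := mul_le_mul_of_nonneg_left h7 (by positivity : 0 ≤ 2 / (7 * q))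
    have h10 : L = 2 / (7 * q) * (7 / 2 * q * L - 2 / q * A) + 4 / 7 / q ^ 2 * A := by
      field_simp
      ring
    rw [h10]
    refine (add_le_add_left h9 _).trans (le_of_eq ?_)
    field_simp
  · have hu1 : ContDiffOn ℝ 1 u (U ∩ {z | z.1 ≠ 0}) :=
      (hu.of_le (by exact_mod_cast le_top)).mono Set.inter_subset_left
    have hT1 : ∀ k : ℝ, ContDiff ℝ 1 fun z : E m n => (gaugePow α z + τ) ^ k := fun k =>
      (hR.add contDiff_const).rpow_const_of_ne fun z => (hTpos z).ne'
    have hN1 : ContDiffOn ℝ 1 (fun z : E m n => ‖z.1‖ ^ (2 * α)) (U ∩ {z | z.1 ≠ 0}) :=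
      ContDiffOn.rpow_const_of_ne (contDiff_fst.contDiffOn.norm ℝ fun z hz => hz.2)
        fun z hz => norm_ne_zero_iff.2 hz.2
    refine ((contDiffOn_const.mul (hu1.mul ((hT1 _).sub contDiff_const).contDiffOn)).smul
      (contDiffOn_gradField hU hu)).add
      ((contDiffOn_const.mul ((hu1.pow 2).mul (hN1.mul (hT1 _).contDiffOn))).smul
      (contDiff_fst.prodMk (contDiff_snd.const_smul (α + 1))).contDiffOn)
  · intro z hz hx
    have h1 : ‖z.1‖ ≤ r := norm_fst_le_of_gaugePow_le hα hr (le_of_lt hz)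
    have h2 : ‖(F z).1‖ ≤ M := (norm_fst_le _).trans (hM z (le_of_lt hz))
    gcongr
  · intro z hz hx
    have hX0 : 0 < ‖z.1‖ := norm_pos_iff.2 hx
    have hzU := hBU hz
    have hT := (hTpos z).ne'
    have h1 := ((hu.contDiffAt (hU.mem_nhds hzU)).differentiableAt (by simp)).hasFDerivAt
    have hR' := ((hR.differentiable one_ne_zero) z).hasFDerivAt.add_const τ
    have hW' := (hR'.rpow_const (p := -e) (Or.inl hT)).sub_const ((c + τ) ^ (-e))
    have hP' := hR'.rpow_const (p := -(e + 1)) (Or.inl hT)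
    have hN' := hasFDerivAt_norm_fst_rpow α hx
    have ha := (h1.mul hW').const_mul 2
    have hb := ((h1.pow 2).mul (hN'.mul hP')).const_mul 4
    have hA1 : DifferentiableAt ℝ (gradField α u) z :=
      ((contDiffOn_gradField hU hu).contDiffAt
        ((hU.inter hX).mem_nhds ⟨hzU, hx⟩)).differentiableAt one_ne_zero
    have hD1 : DifferentiableAt ℝ (dilationField α : E m n → E m n) z :=
      differentiableAt_fst.prodMk (differentiableAt_snd.fun_const_smul (α + 1))
    have h2 := divg_smul ha hA1
    have h3 := divg_smul hb hD1
    have h4 := divg_add (ha.differentiableAt.smul hA1) (hb.differentiableAt.smul hD1)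
    have h5 : divg F z = _ := h4.trans (congrArg₂ (· + ·) h2 h3)
    have h6 : (fderiv ℝ u z) (dilationField α z) = Zop α u z := rfl
    have h8 : inner ℝ z.1 (dilationField α z).1 = ‖z.1‖ ^ 2 := real_inner_self_eq_norm_sq _
    have h9 : ‖z.1‖ ^ (2 * α - 2) * ‖z.1‖ ^ 2 = ‖z.1‖ ^ (2 * α) := by
      rw [← Real.rpow_natCast, ← Real.rpow_add hX0]
      norm_num
    rw [h5, divg_gradField hU hu hzU hx, divg_dilationField]
    simp [fderiv_gaugePow_gradField hα, fderiv_gaugePow_dilationField hα, fderiv_apply_gradField,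
      h6, h8]
    simp only [hd, hW, hg, neg_add_rev, show -e - 1 = -1 + -e by ring]
    linear_combination (-4 * u z * (gaugePow α z + τ) ^ (-1 + -e) * ‖z.1‖ ^ (2 * α) * Zop α u z -
        8 * u z ^ 2 * ‖z.1‖ ^ (2 * α) * gaugePow α z *
          (gaugePow α z + τ) ^ (-1 + -e - 1)) * heβ -
      4 * u z ^ 2 * ‖z.1‖ ^ (2 * α) * (gaugePow α z + τ) ^ (-1 + -e) * hq +
      8 * α * u z ^ 2 * (gaugePow α z + τ) ^ (-1 + -e) * h9
  · exact ((continuousOn_const.mul (hu.continuousOn.mul hWc.continuousOn)).mul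
      ((continuous_const.mul hN).continuousOn.mul hZc)).add
      ((continuousOn_const.mul ((hu.continuousOn.pow 2).mul (hN.mul (hTc _)).continuousOn)).mul
      (continuous_const.mul hR.continuous).continuousOn)
  · intro z _ _ _
    simp only [hH, hF, map_add, map_smul, smul_eq_mul, fderiv_gaugePow_gradField hα,
      fderiv_gaugePow_dilationField hα]

end Rellich

section Limit

variable {m n : ℕ}

/-- Local Rellich inequality on a gauge ball, with the remainder `∫ (Δ_X u)² / |x|²`. -/
theorem integral_sq_mul_psi_div_rho_le (hm : 2 < m) {α r : ℝ} (hα : 0 < α) (hα1 : α ≤ 1)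
    (hQ : 6 < (m : ℝ) + (α + 1) * n) (hr : 0 < r)
    {U : Set (E m n)} (hU : IsOpen U) (hK : {z | gaugePow α z ≤ r ^ (2 * (α + 1))} ⊆ U)
    {u : E m n → ℝ} (hu : ContDiffOn ℝ (⊤ : ℕ∞) u U)
    (hA : IntegrableOn (fun z => lapX α u z ^ 2 * (‖z.1‖ ^ 2)⁻¹)
      {z | gaugePow α z < r ^ (2 * (α + 1))}) :
    ∫ z in (gball α r : Set (E m n)), u z ^ 2 * psi α z / rho α z ^ 6 ≤
      2 / ((m : ℝ) + (α + 1) * n - 6) * (r⁻¹ * r⁻¹ ^ 4 * ∫ z in (gsphere α r : Set (E m n)),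
        u z ^ 2 * psi α z / normGradRho α z ∂μH[(m + n - 1 : ℝ)]) +
      4 / 7 / ((m : ℝ) + (α + 1) * n - 6) ^ 2 *
        ∫ z in {z | gaugePow α z < r ^ (2 * (α + 1))}, lapX α u z ^ 2 * (‖z.1‖ ^ 2)⁻¹ := by
  have hq : 0 < (m : ℝ) + (α + 1) * n - 6 := by linarith
  rw [gball_eq hα hr]
  have hR := contDiff_gaugePow (m := m) (n := n) hα
  set B := {z : E m n | gaugePow α z < r ^ (2 * (α + 1))} with hB
  have hBm : MeasurableSet B := (isOpen_lt hR.continuous continuous_const).measurableSet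
  set Λ := 2 / ((m : ℝ) + (α + 1) * n - 6) * (r⁻¹ * r⁻¹ ^ 4 * ∫ z in (gsphere α r : Set (E m n)),
        u z ^ 2 * psi α z / normGradRho α z ∂μH[(m + n - 1 : ℝ)]) +
      4 / 7 / ((m : ℝ) + (α + 1) * n - 6) ^ 2 * ∫ z in B, lapX α u z ^ 2 * (‖z.1‖ ^ 2)⁻¹ with hΛ
  have hΛ0 : 0 ≤ Λ := by
    have h1 : 0 ≤ ∫ z in (gsphere α r : Set (E m n)),
        u z ^ 2 * psi α z / normGradRho α z ∂μH[(m + n - 1 : ℝ)] :=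
      integral_gsphere_nonneg fun z => sq_nonneg _
    have h2 : 0 ≤ ∫ z in B, lapX α u z ^ 2 * (‖z.1‖ ^ 2)⁻¹ :=
      integral_nonneg fun z => by positivity
    positivity
  set τ : ℕ → ℝ := fun k => 1 / ((k : ℝ) + 1) with hτ
  have hτ0 : ∀ k, 0 < τ k := fun k => by positivity
  set f : ℕ → E m n → ℝ := fun k z => u z ^ 2 * (‖z.1‖ ^ (2 * α) *
    (gaugePow α z + τ k) ^ (-(2 / (α + 1) + 1))) with hf
  have hfk := fun k => integral_sq_mul_gaugePow_add_le hm hα hα1 hQ hr hU hK hu hA (hτ0 k)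
  have hf0 : ∀ k z, 0 ≤ f k z := fun k z => by
    have := gaugePow_nonneg α z
    have := hτ0 k
    positivity
  have hlim : ∀ᵐ z : E m n, Filter.Tendsto (fun k => ENNReal.ofReal (f k z)) Filter.atTop
      (nhds (ENNReal.ofReal (u z ^ 2 * psi α z / rho α z ^ 6))) := by
    filter_upwards [ae_fst_ne_zero (n := n) hm] with z hx
    have hx0 : 0 < ‖z.1‖ := norm_pos_iff.2 hx
    have hR0 : 0 < gaugePow α z := by
      have : 0 < ‖z.1‖ ^ (2 * (α + 1)) := by positivity
      exact add_pos_of_pos_of_nonneg this (by positivity)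
    refine (ENNReal.continuous_ofReal.tendsto _).comp ?_
    rw [mul_div_assoc, psi_div_rho_pow_six hα hR0]
    refine tendsto_const_nhds.mul (tendsto_const_nhds.mul ?_)
    have h1 : Filter.Tendsto (fun k => gaugePow α z + τ k) Filter.atTop
        (nhds (gaugePow α z + 0)) :=
      tendsto_const_nhds.add tendsto_one_div_add_atTop_nhds_zero_nat
    rw [add_zero] at h1
    exact h1.rpow_const (Or.inl hR0.ne')
  have hfatou : ∫⁻ z in B, ENNReal.ofReal (u z ^ 2 * psi α z / rho α z ^ 6) ≤
      ENNReal.ofReal Λ := by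
    calc _ = ∫⁻ z in B, Filter.liminf (fun k => ENNReal.ofReal (f k z)) Filter.atTop := by
          refine lintegral_congr_ae ?_
          filter_upwards [ae_restrict_of_ae hlim] with z hz using hz.liminf_eq.symm
      _ ≤ Filter.liminf (fun k => ∫⁻ z in B, ENNReal.ofReal (f k z)) Filter.atTop :=
          lintegral_liminf_le' fun k => (hfk k).1.aestronglyMeasurable.aemeasurable.ennreal_ofReal
      _ ≤ Filter.liminf (fun _ : ℕ => ENNReal.ofReal Λ) Filter.atTop := by
          refine Filter.liminf_le_liminf (Filter.Eventually.of_forall fun k => ?_)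
          rw [← ofReal_integral_eq_lintegral_ofReal (hfk k).1
            (Filter.Eventually.of_forall fun z => hf0 k z)]
          exact ENNReal.ofReal_le_ofReal (hfk k).2
      _ = _ := Filter.liminf_const _
  exact (ENNReal.ofReal_le_ofReal_iff hΛ0).1
    ((ofReal_integral_le_lintegral_ofReal _).trans hfatou)

end Limit

/-- third-order local Hardy-Rellich inequality for `m > 2`,
`Q = m + (α+1)n > 6`, `0 < α ≤ 1`. -/
theorem local_hardy_rellich_third_order {m n : ℕ} (hm : 2 < m) (hn : 1 ≤ n)
    (α : ℝ) (hα : 0 < α) (hα1 : α ≤ 1) (hQ : 6 < (m : ℝ) + (α+1) * n)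
    (r : ℝ) (hr : 0 < r) (u : E m n → ℝ)
    (hu : ∃ U : Set (E m n), IsOpen U ∧ {z | rho α z ≤ r} ⊆ U ∧ ContDiffOn ℝ (⊤ : ℕ∞) u U) :
    ∫ z in gball (m := m) (n := n) α r, (u z)^2 * psi α z / (rho α z)^6
      ≤ 4 / (((m : ℝ) - 2)^2 * ((m : ℝ) + (α+1) * n - 6)^2) *
          (∫ z in gball (m := m) (n := n) α r, gradXsq α (lapX α u) z)
        + 2 / (((m : ℝ) - 2) * ((m : ℝ) + (α+1) * n - 6)^2) * r⁻¹ *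
          (∫ z in gsphere (m := m) (n := n) α r,
            (lapX α u z)^2 * psi α z / normGradRho α z ∂μH[(m + n - 1 : ℝ)])
        + (2 / ((m : ℝ) + (α+1) * n - 6)) * r^(-5 : ℤ) *
          (∫ z in gsphere (m := m) (n := n) α r,
            (u z)^2 * psi α z / normGradRho α z ∂μH[(m + n - 1 : ℝ)]) := by
  obtain ⟨U, hU, hKU, hu⟩ := hu
  have hK : {z : E m n | gaugePow α z ≤ r ^ (2 * (α + 1))} ⊆ U :=
    fun z hz => hKU ((rho_le_iff hα hr z).2 hz)
  have hsm : ∀ v, ContDiffOn ℝ 1 (fun w => fderiv ℝ (fun w => fderiv ℝ u w v) w v) U := fun v =>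
    (contDiffOn_fderiv_apply hU (contDiffOn_fderiv_apply hU hu v) v).of_le
      (by exact_mod_cast le_top)
  obtain ⟨hA, hardy⟩ := integral_sq_div_norm_fst_sq_le hm hα hr hU hK (g := lapX α u)
    (ContDiffOn.sum fun i _ => hsm (EuclideanSpace.single i 1, 0))
    (ContDiffOn.sum fun j _ => hsm (0, EuclideanSpace.single j 1)) fun z => rfl
  have rellich := integral_sq_mul_psi_div_rho_le hm hα hα1 hQ hr hU hK hu hA
  have hG : 0 ≤ ∫ z in (gball α r : Set (E m n)), gradXsq α (lapX α u) z :=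
    integral_nonneg fun z => by unfold gradXsq; positivity
  rw [← gball_eq hα hr] at hardy rellich
  have hm' : (0 : ℝ) < m - 2 := by
    have : (2 : ℝ) < m := by exact_mod_cast hm
    linarith
  obtain ⟨q, hq⟩ : ∃ q, q = (m : ℝ) + (α + 1) * n - 6 := ⟨_, rfl⟩
  have hq0 : 0 < q := by linarith
  rw [← hq] at rellich ⊢
  rw [show r ^ (-5 : ℤ) = r⁻¹ * r⁻¹ ^ 4 by rw [zpow_neg, ← pow_succ', inv_pow]; norm_cast]
  generalize (∫ z in (gball α r : Set (E m n)), gradXsq α (lapX α u) z) = G at *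
  generalize (∫ z in (gball α r : Set (E m n)), lapX α u z ^ 2 * (‖z.1‖ ^ 2)⁻¹) = A at *
  refine rellich.trans ?_
  have h1 := mul_le_mul_of_nonneg_left hardy (by positivity : 0 ≤ 4 / 7 / q ^ 2)
  have h2 : 4 / 7 / q ^ 2 * (4 / ((m : ℝ) - 2) ^ 2 * G) ≤ 4 / (((m : ℝ) - 2) ^ 2 * q ^ 2) * G := by
    have h3 : 0 ≤ G / (((m : ℝ) - 2) ^ 2 * q ^ 2) := by positivity
    have h4 : 4 / 7 / q ^ 2 * (4 / ((m : ℝ) - 2) ^ 2 * G) =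
        16 / 7 * (G / (((m : ℝ) - 2) ^ 2 * q ^ 2)) := by
      field_simp
      ring
    have h5 : 4 / (((m : ℝ) - 2) ^ 2 * q ^ 2) * G = 4 * (G / (((m : ℝ) - 2) ^ 2 * q ^ 2)) := by
      ring
    linarith
  rw [mul_add] at h1
  have h6 : ∀ b : ℝ, 4 / 7 / q ^ 2 * (7 / 2 / ((m : ℝ) - 2) * (r⁻¹ * b)) =
      2 / (((m : ℝ) - 2) * q ^ 2) * r⁻¹ * b := fun b => by field_simp; norm_num
  rw [h6] at h1
  linarith
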